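/- arXiv:1309.5250 — 2 statements merged into one kernel-verified Lean document; each statement's English description precedes it below -/
import Mathlib

section
/- For every β ∈ Δ, the degree-β homogeneous component of U⁺ (with respect to the Q⁺-grading) is equal to the ℂ-span of those ordered monomials ∏→_{γ∈Δ} ∏_{i=1}^{c_γ} X_γ(n_{i,γ}) — products of root vectors whose factors appear in increasing order of γ ∈ Δ — whose total degree is β. -/
noncomputable section

namespace QAS

open Polynomial
open scoped TensorProduct

/-! ### Basic combinatorial data -/

/-- `l_i = 1` for `i ≤ M`, `-1` otherwise. -/
def lof (M : ℕ) (i : ℕ) : ℤ := if i ≤ M then 1 else -1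

/-- the bilinear form `(ε_i, ε_j) = l_i δ_{ij}`. -/
def innerE (M : ℕ) (i j : ℕ) : ℤ := if i = j then lof M i else 0

/-- `(ε_a − ε_b, ε_c − ε_d)`. -/
def form4 (M : ℕ) (a b c d : ℕ) : ℤ :=
  innerE M a c - innerE M a d - innerE M b c + innerE M b d

/-- the Cartan pairing `c_{ij} = (ε_i − ε_{i+1}, ε_j − ε_{j+1})`. -/
def cc (M : ℕ) (i j : ℕ) : ℤ := form4 M i (i + 1) j (j + 1)

/-- `q_i = q^{l_i}`. -/
def qpar (q : ℂ) (M : ℕ) (i : ℕ) : ℂ := q ^ lof M i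

/-- the quantum integer `[m]_v`. -/
def qint (v : ℂ) (m : ℤ) : ℂ := (v ^ m - v ^ (-m)) / (v - v⁻¹)

/-- the sign `(−1)^{|X_i||X_j|}` for the generators `X_i`, `X_j`. -/
def sgn (M : ℕ) (i j : ℕ) : ℂ := if i = M ∧ j = M then -1 else 1

/-- index set `1 ≤ i ≤ M+N−1`. -/
abbrev Idx (M N : ℕ) := {i : ℕ // 1 ≤ i ∧ i ≤ M + N - 1}

/-! ### Generators and the free superalgebra -/

/-- Drinfel'd generators; when `ext = true` we also have `K₀^{±1}`. -/
inductive Gen (M N : ℕ) (ext : Bool) : Type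
  | Xp : Idx M N → ℤ → Gen M N ext
  | Xm : Idx M N → ℤ → Gen M N ext
  | K : Idx M N → Gen M N ext
  | Ki : Idx M N → Gen M N ext
  | H : Idx M N → {s : ℤ // s ≠ 0} → Gen M N ext
  | K0 : ext = true → Gen M N ext
  | K0i : ext = true → Gen M N ext

abbrev FA (M N : ℕ) (ext : Bool) := FreeAlgebra ℂ (Gen M N ext)

def gi {M N : ℕ} {ext : Bool} (g : Gen M N ext) : FA M N ext := FreeAlgebra.ι ℂ g

def XpF (M N : ℕ) (ext : Bool) (i : ℕ) (n : ℤ) : FA M N ext :=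
  if h : 1 ≤ i ∧ i ≤ M + N - 1 then gi (Gen.Xp ⟨i, h⟩ n) else 0

def XmF (M N : ℕ) (ext : Bool) (i : ℕ) (n : ℤ) : FA M N ext :=
  if h : 1 ≤ i ∧ i ≤ M + N - 1 then gi (Gen.Xm ⟨i, h⟩ n) else 0

def KF (M N : ℕ) (ext : Bool) (i : ℕ) : FA M N ext :=
  if h : 1 ≤ i ∧ i ≤ M + N - 1 then gi (Gen.K ⟨i, h⟩) else 0

def KiF (M N : ℕ) (ext : Bool) (i : ℕ) : FA M N ext :=
  if h : 1 ≤ i ∧ i ≤ M + N - 1 then gi (Gen.Ki ⟨i, h⟩) else 0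

def HF (M N : ℕ) (ext : Bool) (i : ℕ) (s : ℤ) : FA M N ext :=
  if h : (1 ≤ i ∧ i ≤ M + N - 1) ∧ s ≠ 0 then gi (Gen.H ⟨i, h.1⟩ ⟨s, h.2⟩) else 0

def K0F (M N : ℕ) (ext : Bool) : FA M N ext :=
  if h : ext = true then gi (Gen.K0 h) else 0

def K0iF (M N : ℕ) (ext : Bool) : FA M N ext :=
  if h : ext = true then gi (Gen.K0i h) else 0

/-- coefficients of `exp (t · Σ_{s ≥ 1} a_s z^s)`. -/
def expC {A : Type} [Ring A] [Algebra ℂ A] (t : ℂ) (a : ℕ → A) : ℕ → A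
  | 0 => 1
  | n + 1 =>
      ((n : ℂ) + 1)⁻¹ •
        (t • ∑ s ∈ Finset.range (n + 1), ((s : ℂ) + 1) • (a (s + 1) * expC t a (n - s)))
termination_by n => n
decreasing_by omega

/-- `φ⁺_{i,n}`, the coefficient of `z^n` in
`K_i exp((q_i − q_i⁻¹) Σ_{s>0} h_{i,s} z^s)`. -/
def phiPF (q : ℂ) (M N : ℕ) (ext : Bool) (i : ℕ) (n : ℤ) : FA M N ext :=
  if 0 ≤ n then
    KF M N ext i *
      expC (qpar q M i - (qpar q M i)⁻¹) (fun s => HF M N ext i (s : ℤ)) n.toNat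
  else 0

/-- `φ⁻_{i,n}`, the coefficient of `z^n` (`n ≤ 0`) in
`K_i⁻¹ exp(−(q_i − q_i⁻¹) Σ_{s>0} h_{i,−s} z^{−s})`. -/
def phiMF (q : ℂ) (M N : ℕ) (ext : Bool) (i : ℕ) (n : ℤ) : FA M N ext :=
  if n ≤ 0 then
    KiF M N ext i *
      expC (-(qpar q M i - (qpar q M i)⁻¹)) (fun s => HF M N ext i (-(s : ℤ))) (-n).toNat
  else 0

/-- the `u`-bracket `[x,y]_u = xy − u·yx` (for `x` or `y` of even parity). -/
def brF {A : Type} [Ring A] [Module ℂ A] (u : ℂ) (x y : A) : A := x * y - u • (y * x)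

/-- the quartic oscillation expression
`[[[X_{M−1,m}, X_{M,n}]_{q⁻¹}, X_{M+1,k}]_q, X_{M,u}]` (a graded anticommutator in the
outermost bracket, both entries being odd). -/
def oscOf {A : Type} [Ring A] [Module ℂ A] (q : ℂ) (M : ℕ) (X : ℕ → ℤ → A) (m n k u : ℤ) : A :=
  brF q (brF q⁻¹ (X (M - 1) m) (X M n)) (X (M + 1) k) * X M u +
    X M u * brF q (brF q⁻¹ (X (M - 1) m) (X M n)) (X (M + 1) k)

/-! ### The defining relations.
`lvl = 1`: only (R1)–(R3);  `lvl = 2`: (R1)–(R5);  `lvl = 3`: all of (R1)–(R7).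
`ext = true` adds `K₀^{±1}` together with its relations. -/

inductive rel (q : ℂ) (M N : ℕ) (ext : Bool) (lvl : ℕ) : FA M N ext → FA M N ext → Prop
  | KKi (i : Idx M N) : rel q M N ext lvl (gi (Gen.K i) * gi (Gen.Ki i)) 1
  | KiK (i : Idx M N) : rel q M N ext lvl (gi (Gen.Ki i) * gi (Gen.K i)) 1
  | KK (i j : Idx M N) :
      rel q M N ext lvl (gi (Gen.K i) * gi (Gen.K j)) (gi (Gen.K j) * gi (Gen.K i))
  | KKi2 (i j : Idx M N) :
      rel q M N ext lvl (gi (Gen.K i) * gi (Gen.Ki j)) (gi (Gen.Ki j) * gi (Gen.K i))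
  | KiKi (i j : Idx M N) :
      rel q M N ext lvl (gi (Gen.Ki i) * gi (Gen.Ki j)) (gi (Gen.Ki j) * gi (Gen.Ki i))
  | KH (i j : Idx M N) (s : {s : ℤ // s ≠ 0}) :
      rel q M N ext lvl (gi (Gen.K i) * gi (Gen.H j s)) (gi (Gen.H j s) * gi (Gen.K i))
  | KiH (i j : Idx M N) (s : {s : ℤ // s ≠ 0}) :
      rel q M N ext lvl (gi (Gen.Ki i) * gi (Gen.H j s)) (gi (Gen.H j s) * gi (Gen.Ki i))
  | HH (i j : Idx M N) (s t : {s : ℤ // s ≠ 0}) :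
      rel q M N ext lvl (gi (Gen.H i s) * gi (Gen.H j t)) (gi (Gen.H j t) * gi (Gen.H i s))
  | KXp (i j : Idx M N) (n : ℤ) :
      rel q M N ext lvl (gi (Gen.K i) * gi (Gen.Xp j n))
        ((q ^ cc M i.1 j.1) • (gi (Gen.Xp j n) * gi (Gen.K i)))
  | KXm (i j : Idx M N) (n : ℤ) :
      rel q M N ext lvl (gi (Gen.K i) * gi (Gen.Xm j n))
        ((q ^ (-cc M i.1 j.1)) • (gi (Gen.Xm j n) * gi (Gen.K i)))
  | HXp (i j : Idx M N) (s : {s : ℤ // s ≠ 0}) (n : ℤ) :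
      rel q M N ext lvl
        (gi (Gen.H i s) * gi (Gen.Xp j n) - gi (Gen.Xp j n) * gi (Gen.H i s))
        ((qint (qpar q M i.1) (s.1 * lof M i.1 * cc M i.1 j.1) / (s.1 : ℂ)) •
          gi (Gen.Xp j (n + s.1)))
  | HXm (i j : Idx M N) (s : {s : ℤ // s ≠ 0}) (n : ℤ) :
      rel q M N ext lvl
        (gi (Gen.H i s) * gi (Gen.Xm j n) - gi (Gen.Xm j n) * gi (Gen.H i s))
        (-((qint (qpar q M i.1) (s.1 * lof M i.1 * cc M i.1 j.1) / (s.1 : ℂ)) •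
          gi (Gen.Xm j (n + s.1))))
  | XpXm (i j : Idx M N) (m n : ℤ) :
      rel q M N ext lvl
        (gi (Gen.Xp i m) * gi (Gen.Xm j n) -
          sgn M i.1 j.1 • (gi (Gen.Xm j n) * gi (Gen.Xp i m)))
        (if i = j then
            (qpar q M i.1 - (qpar q M i.1)⁻¹)⁻¹ •
              (phiPF q M N ext i.1 (m + n) - phiMF q M N ext i.1 (m + n))
          else 0)
  | XX0p (i j : Idx M N) (m n : ℤ) (h2 : 2 ≤ lvl) (h : cc M i.1 j.1 = 0) :
      rel q M N ext lvl
        (gi (Gen.Xp i m) * gi (Gen.Xp j n) -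
          sgn M i.1 j.1 • (gi (Gen.Xp j n) * gi (Gen.Xp i m))) 0
  | XX0m (i j : Idx M N) (m n : ℤ) (h2 : 2 ≤ lvl) (h : cc M i.1 j.1 = 0) :
      rel q M N ext lvl
        (gi (Gen.Xm i m) * gi (Gen.Xm j n) -
          sgn M i.1 j.1 • (gi (Gen.Xm j n) * gi (Gen.Xm i m))) 0
  | XXp (i j : Idx M N) (m n : ℤ) (h2 : 2 ≤ lvl) (h : cc M i.1 j.1 ≠ 0) :
      rel q M N ext lvl
        (gi (Gen.Xp i (m + 1)) * gi (Gen.Xp j n) -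
          (q ^ cc M i.1 j.1) • (gi (Gen.Xp j n) * gi (Gen.Xp i (m + 1))))
        ((q ^ cc M i.1 j.1) • (gi (Gen.Xp i m) * gi (Gen.Xp j (n + 1))) -
          gi (Gen.Xp j (n + 1)) * gi (Gen.Xp i m))
  | XXm (i j : Idx M N) (m n : ℤ) (h2 : 2 ≤ lvl) (h : cc M i.1 j.1 ≠ 0) :
      rel q M N ext lvl
        (gi (Gen.Xm i (m + 1)) * gi (Gen.Xm j n) -
          (q ^ (-cc M i.1 j.1)) • (gi (Gen.Xm j n) * gi (Gen.Xm i (m + 1))))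
        ((q ^ (-cc M i.1 j.1)) • (gi (Gen.Xm i m) * gi (Gen.Xm j (n + 1))) -
          gi (Gen.Xm j (n + 1)) * gi (Gen.Xm i m))
  | serreP (i j : Idx M N) (m n k : ℤ) (h3 : 3 ≤ lvl)
      (h : cc M i.1 j.1 = 1 ∨ cc M i.1 j.1 = -1) (hi : i.1 ≠ M) :
      rel q M N ext lvl
        (brF q (gi (Gen.Xp i m)) (brF q⁻¹ (gi (Gen.Xp i n)) (gi (Gen.Xp j k))) +
          brF q (gi (Gen.Xp i n)) (brF q⁻¹ (gi (Gen.Xp i m)) (gi (Gen.Xp j k)))) 0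
  | serreM (i j : Idx M N) (m n k : ℤ) (h3 : 3 ≤ lvl)
      (h : cc M i.1 j.1 = 1 ∨ cc M i.1 j.1 = -1) (hi : i.1 ≠ M) :
      rel q M N ext lvl
        (brF q (gi (Gen.Xm i m)) (brF q⁻¹ (gi (Gen.Xm i n)) (gi (Gen.Xm j k))) +
          brF q (gi (Gen.Xm i n)) (brF q⁻¹ (gi (Gen.Xm i m)) (gi (Gen.Xm j k)))) 0
  | oscP (m n k u : ℤ) (h3 : 3 ≤ lvl) (hM : 1 < M) (hN : 1 < N) :
      rel q M N ext lvl
        (oscOf q M (XpF M N ext) m n k u + oscOf q M (XpF M N ext) m u k n) 0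
  | oscM (m n k u : ℤ) (h3 : 3 ≤ lvl) (hM : 1 < M) (hN : 1 < N) :
      rel q M N ext lvl
        (oscOf q M (XmF M N ext) m n k u + oscOf q M (XmF M N ext) m u k n) 0
  | K0K0i (he : ext = true) : rel q M N ext lvl (gi (Gen.K0 he) * gi (Gen.K0i he)) 1
  | K0iK0 (he : ext = true) : rel q M N ext lvl (gi (Gen.K0i he) * gi (Gen.K0 he)) 1
  | K0K (he : ext = true) (i : Idx M N) :
      rel q M N ext lvl (gi (Gen.K0 he) * gi (Gen.K i)) (gi (Gen.K i) * gi (Gen.K0 he))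
  | K0Ki (he : ext = true) (i : Idx M N) :
      rel q M N ext lvl (gi (Gen.K0 he) * gi (Gen.Ki i)) (gi (Gen.Ki i) * gi (Gen.K0 he))
  | K0H (he : ext = true) (i : Idx M N) (s : {s : ℤ // s ≠ 0}) :
      rel q M N ext lvl (gi (Gen.K0 he) * gi (Gen.H i s)) (gi (Gen.H i s) * gi (Gen.K0 he))
  | K0Xp (he : ext = true) (i : Idx M N) (n : ℤ) :
      rel q M N ext lvl (gi (Gen.K0 he) * gi (Gen.Xp i n))
        ((q ^ (if i.1 = 1 then (1 : ℤ) else 0)) • (gi (Gen.Xp i n) * gi (Gen.K0 he)))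
  | K0Xm (he : ext = true) (i : Idx M N) (n : ℤ) :
      rel q M N ext lvl (gi (Gen.K0 he) * gi (Gen.Xm i n))
        ((q ^ (if i.1 = 1 then (-1 : ℤ) else 0)) • (gi (Gen.Xm i n) * gi (Gen.K0 he)))

/-! ### The quantum affine superalgebras -/

abbrev ALG (q : ℂ) (M N : ℕ) (ext : Bool) (lvl : ℕ) := RingQuot (rel q M N ext lvl)

def mkA (q : ℂ) (M N : ℕ) (ext : Bool) (lvl : ℕ) : FA M N ext →ₐ[ℂ] ALG q M N ext lvl :=
  RingQuot.mkAlgHom ℂ (rel q M N ext lvl)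

def XpA (q : ℂ) (M N : ℕ) (ext : Bool) (lvl : ℕ) (i : ℕ) (n : ℤ) : ALG q M N ext lvl :=
  mkA q M N ext lvl (XpF M N ext i n)

def XmA (q : ℂ) (M N : ℕ) (ext : Bool) (lvl : ℕ) (i : ℕ) (n : ℤ) : ALG q M N ext lvl :=
  mkA q M N ext lvl (XmF M N ext i n)

def KA (q : ℂ) (M N : ℕ) (ext : Bool) (lvl : ℕ) (i : ℕ) : ALG q M N ext lvl :=
  mkA q M N ext lvl (KF M N ext i)

def KiA (q : ℂ) (M N : ℕ) (ext : Bool) (lvl : ℕ) (i : ℕ) : ALG q M N ext lvl :=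
  mkA q M N ext lvl (KiF M N ext i)

def HA (q : ℂ) (M N : ℕ) (ext : Bool) (lvl : ℕ) (i : ℕ) (s : ℤ) : ALG q M N ext lvl :=
  mkA q M N ext lvl (HF M N ext i s)

def K0A (q : ℂ) (M N : ℕ) (ext : Bool) (lvl : ℕ) : ALG q M N ext lvl :=
  mkA q M N ext lvl (K0F M N ext)

def K0iA (q : ℂ) (M N : ℕ) (ext : Bool) (lvl : ℕ) : ALG q M N ext lvl :=
  mkA q M N ext lvl (K0iF M N ext)

def phiPA (q : ℂ) (M N : ℕ) (ext : Bool) (lvl : ℕ) (i : ℕ) (n : ℤ) : ALG q M N ext lvl :=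
  mkA q M N ext lvl (phiPF q M N ext i n)

def phiMA (q : ℂ) (M N : ℕ) (ext : Bool) (lvl : ℕ) (i : ℕ) (n : ℤ) : ALG q M N ext lvl :=
  mkA q M N ext lvl (phiMF q M N ext i n)

/-- `U⁺`: the subalgebra generated by the `X⁺_{i,n}`. -/
def Aplus (q : ℂ) (M N : ℕ) (ext : Bool) (lvl : ℕ) : Subalgebra ℂ (ALG q M N ext lvl) :=
  Algebra.adjoin ℂ {x | ∃ i : ℕ, ∃ n : ℤ, x = XpA q M N ext lvl i n}

/-- `U⁻`: the subalgebra generated by the `X⁻_{i,n}`. -/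
def Aminus (q : ℂ) (M N : ℕ) (ext : Bool) (lvl : ℕ) : Subalgebra ℂ (ALG q M N ext lvl) :=
  Algebra.adjoin ℂ {x | ∃ i : ℕ, ∃ n : ℤ, x = XmA q M N ext lvl i n}

/-- `U⁰`: the subalgebra generated by the `K_i^{±1}` and `h_{i,s}`. -/
def Azero (q : ℂ) (M N : ℕ) (ext : Bool) (lvl : ℕ) : Subalgebra ℂ (ALG q M N ext lvl) :=
  Algebra.adjoin ℂ {x | (∃ i : ℕ, x = KA q M N ext lvl i) ∨ (∃ i : ℕ, x = KiA q M N ext lvl i) ∨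
    ∃ i : ℕ, ∃ s : ℤ, x = HA q M N ext lvl i s}

/-- `U'⁰`: the subalgebra generated by `U⁰` and `K₀^{±1}`. -/
def AzeroE (q : ℂ) (M N : ℕ) (ext : Bool) (lvl : ℕ) : Subalgebra ℂ (ALG q M N ext lvl) :=
  Algebra.adjoin ℂ {x | (∃ i : ℕ, x = KA q M N ext lvl i) ∨ (∃ i : ℕ, x = KiA q M N ext lvl i) ∨
    (∃ i : ℕ, ∃ s : ℤ, x = HA q M N ext lvl i s) ∨ x = K0A q M N ext lvl ∨
      x = K0iA q M N ext lvl}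

/-! ### The multiplication map on the triple tensor product -/

def triMul (q : ℂ) (M N : ℕ) (ext : Bool) (lvl : ℕ)
    (S T R : Subalgebra ℂ (ALG q M N ext lvl)) :
    (↥S ⊗[ℂ] (↥T ⊗[ℂ] ↥R)) →ₗ[ℂ] ALG q M N ext lvl :=
  TensorProduct.lift
    (((LinearMap.mul ℂ (ALG q M N ext lvl)).comp S.val.toLinearMap).compl₂
      (TensorProduct.lift
        (((LinearMap.mul ℂ (ALG q M N ext lvl)).comp T.val.toLinearMap).compl₂
          R.val.toLinearMap)))

/-! ### Root vectors and PBW monomials -/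

def Xroot (q : ℂ) (M N : ℕ) (ext : Bool) (lvl : ℕ) (i : ℕ) : ℕ → ℤ → ALG q M N ext lvl
  | 0, n => XpA q M N ext lvl i n
  | k + 1, n =>
      brF (qpar q M (i + k + 1)) (Xroot q M N ext lvl i k n) (XpA q M N ext lvl (i + k + 1) 0)

/-- the root vector `X_{α_i + ⋯ + α_j}(n)`. -/
def XrootIJ (q : ℂ) (M N : ℕ) (ext : Bool) (lvl : ℕ) (i j : ℕ) (n : ℤ) : ALG q M N ext lvl :=
  Xroot q M N ext lvl i (j - i) n

def rootLE (a b : ℕ × ℕ) : Prop := a.1 < b.1 ∨ (a.1 = b.1 ∧ a.2 ≤ b.2)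

/-- the set of PBW ordered monomials in the root vectors. -/
def pbwSet (q : ℂ) (M N : ℕ) (ext : Bool) (lvl : ℕ) : Set (ALG q M N ext lvl) :=
  {x | ∃ L : List ((ℕ × ℕ) × ℤ),
      (∀ p ∈ L, 1 ≤ p.1.1 ∧ p.1.1 ≤ p.1.2 ∧ p.1.2 ≤ M + N - 1) ∧
      L.Chain' (fun a b => rootLE a.1 b.1) ∧
      x = (L.map fun p => XrootIJ q M N ext lvl p.1.1 p.1.2 p.2).prod}

/-- PBW ordered monomials of total degree `d` (`d i` counts the multiplicity of `α_i`). -/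
def pbwDegSet (q : ℂ) (M N : ℕ) (ext : Bool) (lvl : ℕ) (d : ℕ → ℕ) : Set (ALG q M N ext lvl) :=
  {x | ∃ L : List ((ℕ × ℕ) × ℤ),
      (∀ p ∈ L, 1 ≤ p.1.1 ∧ p.1.1 ≤ p.1.2 ∧ p.1.2 ≤ M + N - 1) ∧
      L.Chain' (fun a b => rootLE a.1 b.1) ∧
      (∀ i : ℕ, ((L.map fun p => if p.1.1 ≤ i ∧ i ≤ p.1.2 then 1 else 0).sum) = d i) ∧
      x = (L.map fun p => XrootIJ q M N ext lvl p.1.1 p.1.2 p.2).prod}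

/-- words in the generators `X⁺_{i,n}` of degree `d`. -/
def wordDegSet (q : ℂ) (M N : ℕ) (ext : Bool) (lvl : ℕ) (d : ℕ → ℕ) :
    Set (ALG q M N ext lvl) :=
  {x | ∃ w : List (ℕ × ℤ), (∀ p ∈ w, 1 ≤ p.1 ∧ p.1 ≤ M + N - 1) ∧
      (∀ i : ℕ, (w.map Prod.fst).count i = d i) ∧
      x = (w.map fun p => XpA q M N ext lvl p.1 p.2).prod}

/-! ### The subspaces `I^±_{i,j}` and `O^±` -/

def IElt (q : ℂ) (M N : ℕ) (ext : Bool) (lvl : ℕ) (pl : Bool) (i j : ℕ) (m n : ℤ) :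
    ALG q M N ext lvl :=
  let X : ℕ → ℤ → ALG q M N ext lvl := if pl then XpA q M N ext lvl else XmA q M N ext lvl
  let e : ℤ := if pl then cc M i j else -cc M i j
  if cc M i j = 0 then X i m * X j n - sgn M i j • (X j n * X i m)
  else
    X i (m + 1) * X j n - (q ^ e) • (X j n * X i (m + 1)) -
      (q ^ e) • (X i m * X j (n + 1)) + X j (n + 1) * X i m

def Isub (q : ℂ) (M N : ℕ) (ext : Bool) (lvl : ℕ) (pl : Bool) (i j : ℕ) :
    Submodule ℂ (ALG q M N ext lvl) :=
  Submodule.span ℂ (Set.range fun p : ℤ × ℤ => IElt q M N ext lvl pl i j p.1 p.2)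

def IsubAll (q : ℂ) (M N : ℕ) (ext : Bool) (lvl : ℕ) (pl : Bool) :
    Submodule ℂ (ALG q M N ext lvl) :=
  ⨆ p : ℕ × ℕ, ⨆ _ : 1 ≤ p.1 ∧ p.1 ≤ p.2 ∧ p.2 ≤ M + N - 1,
    Isub q M N ext lvl pl p.1 p.2

def OscElt (q : ℂ) (M N : ℕ) (ext : Bool) (lvl : ℕ) (pl : Bool) (m n k u : ℤ) :
    ALG q M N ext lvl :=
  let X : ℕ → ℤ → ALG q M N ext lvl := if pl then XpA q M N ext lvl else XmA q M N ext lvl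
  oscOf q M X m n k u + oscOf q M X m u k n

def Osub (q : ℂ) (M N : ℕ) (ext : Bool) (lvl : ℕ) (pl : Bool) :
    Submodule ℂ (ALG q M N ext lvl) :=
  Submodule.span ℂ
    (Set.range fun p : ℤ × ℤ × ℤ × ℤ => OscElt q M N ext lvl pl p.1 p.2.1 p.2.2.1 p.2.2.2)

/-- the sign `(−1)^{(p(α_k)+p(α_u))·p(α_i)}`. -/
def gsgn (M : ℕ) (k u i : ℕ) : ℂ :=
  if ((k = M ∧ ¬u = M) ∨ (¬k = M ∧ u = M)) ∧ i = M then -1 else 1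

/-! ### Highest weights and the associated eigenvalue sequences -/

/-- `Q·f = 0` for a bilateral formal series `f`. -/
def annih (Q : Polynomial ℂ) (f : ℤ → ℂ) : Prop :=
  ∀ n : ℤ, ∑ s ∈ Finset.range (Q.natDegree + 1), Q.coeff s * f (n - s) = 0

/-- an element of `R_{M,N}`: a highest weight `(P̲, f, c)`. -/
structure HW (q : ℂ) (M N : ℕ) : Type where
  P : ℕ → Polynomial ℂ
  f : ℤ → ℂ
  c : ℂ
  P_const : ∀ i, (P i).coeff 0 = 1
  c_ne : c ≠ 0
  torsion : ∃ Q : Polynomial ℂ, Q ≠ 0 ∧ annih Q f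
  f_zero : f 0 = (c - c⁻¹) / (q - q⁻¹)

def toPS (p : Polynomial ℂ) : PowerSeries ℂ := PowerSeries.mk fun n => p.coeff n

/-- `P(z·u)`. -/
def pscale (u : ℂ) (P : Polynomial ℂ) : Polynomial ℂ := P.comp (Polynomial.C u * Polynomial.X)

/-- the coefficient of `z^n` (`n ≥ 0`) in `q_i^{deg P} P(z q_i⁻¹)/P(z q_i)`,
expanded at `z = 0`. -/
def gammaP (q : ℂ) (M : ℕ) (i : ℕ) (P : Polynomial ℂ) (n : ℤ) : ℂ :=
  if 0 ≤ n then
    qpar q M i ^ P.natDegree *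
      PowerSeries.coeff n.toNat
        (toPS (pscale (qpar q M i)⁻¹ P) * (toPS (pscale (qpar q M i) P))⁻¹)
  else 0

/-- the coefficient of `z^n` (`n ≤ 0`) in `q_i^{deg P} P(z q_i⁻¹)/P(z q_i)`,
expanded at `z = ∞`. -/
def gammaM (q : ℂ) (M : ℕ) (i : ℕ) (P : Polynomial ℂ) (n : ℤ) : ℂ :=
  if n ≤ 0 then
    qpar q M i ^ P.natDegree *
      PowerSeries.coeff (-n).toNat
        (toPS ((pscale (qpar q M i)⁻¹ P).reflect P.natDegree) *
          (toPS ((pscale (qpar q M i) P).reflect P.natDegree))⁻¹)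
  else 0

/-! ### Verma, Weyl and simple modules -/

def vermaRels (q : ℂ) (M N : ℕ) (ext : Bool) (Λ : HW q M N) : Set (ALG q M N ext 3) :=
  {x | ∃ i : ℕ, ∃ n : ℤ, x = XpA q M N ext 3 i n} ∪
  {x | ∃ i : ℕ, ∃ n : ℤ, 1 ≤ i ∧ i ≤ M + N - 1 ∧ i ≠ M ∧
      (x = phiPA q M N ext 3 i n - algebraMap ℂ _ (gammaP q M i (Λ.P i) n) ∨
       x = phiMA q M N ext 3 i n - algebraMap ℂ _ (gammaM q M i (Λ.P i) n))} ∪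
  {x | x = KA q M N ext 3 M - algebraMap ℂ _ Λ.c} ∪
  {x | ∃ n : ℤ, x = phiPA q M N ext 3 M n - phiMA q M N ext 3 M n -
      algebraMap ℂ _ ((q - q⁻¹) * Λ.f n)} ∪
  {x | ext = true ∧ x = K0A q M N ext 3 - 1}

def evenRels (q : ℂ) (M N : ℕ) (ext : Bool) (Λ : HW q M N) : Set (ALG q M N ext 3) :=
  {x | ∃ i : ℕ, 1 ≤ i ∧ i ≤ M + N - 1 ∧ i ≠ M ∧
      x = XmA q M N ext 3 i 0 ^ (1 + (Λ.P i).natDegree)}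

def oddElt (q : ℂ) (M N : ℕ) (ext : Bool) (Q : Polynomial ℂ) (n : ℤ) : ALG q M N ext 3 :=
  ∑ s ∈ Finset.range (Q.natDegree + 1),
    Q.coeff (Q.natDegree - s) • XmA q M N ext 3 M ((s : ℤ) + n)

def oddRels (q : ℂ) (M N : ℕ) (ext : Bool) (Q : Polynomial ℂ) : Set (ALG q M N ext 3) :=
  if M = 1 ∧ N = 1 then {x | ∃ n : ℤ, x = oddElt q M N ext Q n}
  else {oddElt q M N ext Q 0}

def vermaIdeal (q : ℂ) (M N : ℕ) (ext : Bool) (Λ : HW q M N) : Ideal (ALG q M N ext 3) :=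
  Ideal.span (vermaRels q M N ext Λ)

def weylIdeal (q : ℂ) (M N : ℕ) (ext : Bool) (Λ : HW q M N) (Q : Polynomial ℂ) :
    Ideal (ALG q M N ext 3) :=
  Ideal.span (vermaRels q M N ext Λ ∪ evenRels q M N ext Λ ∪ oddRels q M N ext Q)

def uweylIdeal (q : ℂ) (M N : ℕ) (ext : Bool) (Λ : HW q M N) : Ideal (ALG q M N ext 3) :=
  Ideal.span (vermaRels q M N ext Λ ∪ evenRels q M N ext Λ)

/-- the Verma module `M(Λ)`. -/
def VermaMod (q : ℂ) (M N : ℕ) (ext : Bool) (Λ : HW q M N) : Type :=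
  ALG q M N ext 3 ⧸ vermaIdeal q M N ext Λ

/-- the Weyl module `W(Λ; Q)`. -/
def WeylMod (q : ℂ) (M N : ℕ) (ext : Bool) (Λ : HW q M N) (Q : Polynomial ℂ) : Type :=
  ALG q M N ext 3 ⧸ weylIdeal q M N ext Λ Q

/-- the universal Weyl module `W(Λ)`. -/
def UWeylMod (q : ℂ) (M N : ℕ) (ext : Bool) (Λ : HW q M N) : Type :=
  ALG q M N ext 3 ⧸ uweylIdeal q M N ext Λ

instance (q : ℂ) (M N : ℕ) (ext : Bool) (Λ : HW q M N) : AddCommGroup (VermaMod q M N ext Λ) :=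
  inferInstanceAs (AddCommGroup (ALG q M N ext 3 ⧸ vermaIdeal q M N ext Λ))
instance (q : ℂ) (M N : ℕ) (ext : Bool) (Λ : HW q M N) :
    Module (ALG q M N ext 3) (VermaMod q M N ext Λ) :=
  inferInstanceAs (Module (ALG q M N ext 3) (ALG q M N ext 3 ⧸ vermaIdeal q M N ext Λ))
instance (q : ℂ) (M N : ℕ) (ext : Bool) (Λ : HW q M N) : Module ℂ (VermaMod q M N ext Λ) :=
  inferInstanceAs (Module ℂ (ALG q M N ext 3 ⧸ vermaIdeal q M N ext Λ))
instance (q : ℂ) (M N : ℕ) (ext : Bool) (Λ : HW q M N) :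
    IsScalarTower ℂ (ALG q M N ext 3) (VermaMod q M N ext Λ) :=
  inferInstanceAs (IsScalarTower ℂ (ALG q M N ext 3) (ALG q M N ext 3 ⧸ vermaIdeal q M N ext Λ))

instance (q : ℂ) (M N : ℕ) (ext : Bool) (Λ : HW q M N) (Q : Polynomial ℂ) :
    AddCommGroup (WeylMod q M N ext Λ Q) :=
  inferInstanceAs (AddCommGroup (ALG q M N ext 3 ⧸ weylIdeal q M N ext Λ Q))
instance (q : ℂ) (M N : ℕ) (ext : Bool) (Λ : HW q M N) (Q : Polynomial ℂ) :
    Module (ALG q M N ext 3) (WeylMod q M N ext Λ Q) :=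
  inferInstanceAs (Module (ALG q M N ext 3) (ALG q M N ext 3 ⧸ weylIdeal q M N ext Λ Q))
instance (q : ℂ) (M N : ℕ) (ext : Bool) (Λ : HW q M N) (Q : Polynomial ℂ) :
    Module ℂ (WeylMod q M N ext Λ Q) :=
  inferInstanceAs (Module ℂ (ALG q M N ext 3 ⧸ weylIdeal q M N ext Λ Q))
instance (q : ℂ) (M N : ℕ) (ext : Bool) (Λ : HW q M N) (Q : Polynomial ℂ) :
    IsScalarTower ℂ (ALG q M N ext 3) (WeylMod q M N ext Λ Q) :=
  inferInstanceAs
    (IsScalarTower ℂ (ALG q M N ext 3) (ALG q M N ext 3 ⧸ weylIdeal q M N ext Λ Q))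

instance (q : ℂ) (M N : ℕ) (ext : Bool) (Λ : HW q M N) : AddCommGroup (UWeylMod q M N ext Λ) :=
  inferInstanceAs (AddCommGroup (ALG q M N ext 3 ⧸ uweylIdeal q M N ext Λ))
instance (q : ℂ) (M N : ℕ) (ext : Bool) (Λ : HW q M N) :
    Module (ALG q M N ext 3) (UWeylMod q M N ext Λ) :=
  inferInstanceAs (Module (ALG q M N ext 3) (ALG q M N ext 3 ⧸ uweylIdeal q M N ext Λ))
instance (q : ℂ) (M N : ℕ) (ext : Bool) (Λ : HW q M N) : Module ℂ (UWeylMod q M N ext Λ) :=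
  inferInstanceAs (Module ℂ (ALG q M N ext 3 ⧸ uweylIdeal q M N ext Λ))
instance (q : ℂ) (M N : ℕ) (ext : Bool) (Λ : HW q M N) :
    IsScalarTower ℂ (ALG q M N ext 3) (UWeylMod q M N ext Λ) :=
  inferInstanceAs (IsScalarTower ℂ (ALG q M N ext 3) (ALG q M N ext 3 ⧸ uweylIdeal q M N ext Λ))

/-- the highest weight vector (image of `1`). -/
def vgen (q : ℂ) (M N : ℕ) (Λ : HW q M N) : VermaMod q M N true Λ :=
  Submodule.Quotient.mk 1

/-- the sum of all submodules not containing the highest weight vector (the unique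
maximal submodule of the Verma module). -/
def radV (q : ℂ) (M N : ℕ) (Λ : HW q M N) :
    Submodule (ALG q M N true 3) (VermaMod q M N true Λ) :=
  sSup {p | vgen q M N Λ ∉ p}

/-- the simple quotient `S'(Λ)`. -/
def SimpMod (q : ℂ) (M N : ℕ) (Λ : HW q M N) : Type :=
  VermaMod q M N true Λ ⧸ radV q M N Λ

instance (q : ℂ) (M N : ℕ) (Λ : HW q M N) : AddCommGroup (SimpMod q M N Λ) :=
  inferInstanceAs (AddCommGroup (VermaMod q M N true Λ ⧸ radV q M N Λ))
instance (q : ℂ) (M N : ℕ) (Λ : HW q M N) :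
    Module (ALG q M N true 3) (SimpMod q M N Λ) :=
  inferInstanceAs (Module (ALG q M N true 3) (VermaMod q M N true Λ ⧸ radV q M N Λ))
instance (q : ℂ) (M N : ℕ) (Λ : HW q M N) : Module ℂ (SimpMod q M N Λ) :=
  inferInstanceAs (Module ℂ (VermaMod q M N true Λ ⧸ radV q M N Λ))
instance (q : ℂ) (M N : ℕ) (Λ : HW q M N) :
    IsScalarTower ℂ (ALG q M N true 3) (SimpMod q M N Λ) :=
  inferInstanceAs (IsScalarTower ℂ (ALG q M N true 3) (VermaMod q M N true Λ ⧸ radV q M N Λ))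

/-! ### Weight spaces -/

/-- `K_i` for `0 ≤ i`, with `K₀` at `i = 0`. -/
def Kgen (q : ℂ) (M N : ℕ) (ext : Bool) (lvl : ℕ) (i : ℕ) : ALG q M N ext lvl :=
  if i = 0 then K0A q M N ext lvl else KA q M N ext lvl i

/-- the `μ`-weight space of a module. -/
def wtSp (q : ℂ) (M N : ℕ) (ext : Bool) {W : Type} [AddCommGroup W] [Module ℂ W]
    [Module (ALG q M N ext 3) W] [IsScalarTower ℂ (ALG q M N ext 3) W] (μ : ℕ → ℂ) :
    Submodule ℂ W where
  carrier := {w | ∀ i < M + N, Kgen q M N ext 3 i • w = μ i • w}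
  add_mem' := by
    intro a b ha hb i hi
    rw [smul_add, ha i hi, hb i hi, smul_add]
  zero_mem' := by
    intro i hi
    rw [smul_zero, smul_zero]
  smul_mem' := by
    intro c w hw i hi
    have h1 : Kgen q M N ext 3 i • (c • w) = c • (Kgen q M N ext 3 i • w) := by
      rw [← algebraMap_smul (ALG q M N ext 3) c w, ← mul_smul, ← Algebra.commutes, mul_smul,
        algebraMap_smul]
    rw [h1, hw i hi, smul_comm]

/-- the character `λ_Λ`. -/
def lamF (q : ℂ) (M N : ℕ) (Λ : HW q M N) : ℕ → ℂ :=
  fun i => if i = 0 then 1 else if i = M then Λ.c else qpar q M i ^ (Λ.P i).natDegree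

/-- the character `α_j`. -/
def alF (q : ℂ) (M : ℕ) (j : ℕ) : ℕ → ℂ :=
  fun i => if i = 0 then (if j = 1 then q else 1) else q ^ cc M j i

/-! ### The generators of `U` inside `U'` -/

def UGenSet (q : ℂ) (M N : ℕ) : Set (ALG q M N true 3) :=
  {x | (∃ i : ℕ, ∃ n : ℤ, x = XpA q M N true 3 i n) ∨
    (∃ i : ℕ, ∃ n : ℤ, x = XmA q M N true 3 i n) ∨
    (∃ i : ℕ, x = KA q M N true 3 i) ∨ (∃ i : ℕ, x = KiA q M N true 3 i) ∨
    ∃ i : ℕ, ∃ s : ℤ, x = HA q M N true 3 i s}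

/-! ### One-sided presentations (for `U^±`) -/

def XgF (M N : ℕ) (i : ℕ) (n : ℤ) : FreeAlgebra ℂ (Idx M N × ℤ) :=
  if h : 1 ≤ i ∧ i ≤ M + N - 1 then FreeAlgebra.ι ℂ ((⟨i, h⟩, n) : Idx M N × ℤ) else 0

inductive rel1 (q : ℂ) (M N : ℕ) (pl : Bool) :
    FreeAlgebra ℂ (Idx M N × ℤ) → FreeAlgebra ℂ (Idx M N × ℤ) → Prop
  | comm0 (i j : Idx M N) (m n : ℤ) (h : cc M i.1 j.1 = 0) :
      rel1 q M N pl
        (FreeAlgebra.ι ℂ ((i, m) : Idx M N × ℤ) * FreeAlgebra.ι ℂ ((j, n) : Idx M N × ℤ) -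
          sgn M i.1 j.1 •
            (FreeAlgebra.ι ℂ ((j, n) : Idx M N × ℤ) * FreeAlgebra.ι ℂ ((i, m) : Idx M N × ℤ))) 0
  | deg2 (i j : Idx M N) (m n : ℤ) (h : cc M i.1 j.1 ≠ 0) :
      rel1 q M N pl
        (FreeAlgebra.ι ℂ ((i, m + 1) : Idx M N × ℤ) * FreeAlgebra.ι ℂ ((j, n) : Idx M N × ℤ) -
          (q ^ (if pl then cc M i.1 j.1 else -cc M i.1 j.1)) •
            (FreeAlgebra.ι ℂ ((j, n) : Idx M N × ℤ) *
              FreeAlgebra.ι ℂ ((i, m + 1) : Idx M N × ℤ)))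
        ((q ^ (if pl then cc M i.1 j.1 else -cc M i.1 j.1)) •
            (FreeAlgebra.ι ℂ ((i, m) : Idx M N × ℤ) *
              FreeAlgebra.ι ℂ ((j, n + 1) : Idx M N × ℤ)) -
          FreeAlgebra.ι ℂ ((j, n + 1) : Idx M N × ℤ) * FreeAlgebra.ι ℂ ((i, m) : Idx M N × ℤ))
  | serre (i j : Idx M N) (m n k : ℤ) (h : cc M i.1 j.1 = 1 ∨ cc M i.1 j.1 = -1)
      (hi : i.1 ≠ M) :
      rel1 q M N pl
        (brF q (FreeAlgebra.ι ℂ ((i, m) : Idx M N × ℤ))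
            (brF q⁻¹ (FreeAlgebra.ι ℂ ((i, n) : Idx M N × ℤ))
              (FreeAlgebra.ι ℂ ((j, k) : Idx M N × ℤ))) +
          brF q (FreeAlgebra.ι ℂ ((i, n) : Idx M N × ℤ))
            (brF q⁻¹ (FreeAlgebra.ι ℂ ((i, m) : Idx M N × ℤ))
              (FreeAlgebra.ι ℂ ((j, k) : Idx M N × ℤ)))) 0
  | osc (m n k u : ℤ) (hM : 1 < M) (hN : 1 < N) :
      rel1 q M N pl (oscOf q M (XgF M N) m n k u + oscOf q M (XgF M N) m u k n) 0

end QAS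

namespace QAS

theorem cc_far (M i j : ℕ) (h : i + 2 ≤ j ∨ j + 2 ≤ i) : cc M i j = 0 := by
  unfold cc form4 innerE
  rw [if_neg (by omega), if_neg (by omega), if_neg (by omega), if_neg (by omega)]; simp

theorem cc_succ (M i : ℕ) : cc M i (i + 1) = - lof M (i + 1) := by
  unfold cc form4 innerE
  rw [if_neg (by omega), if_neg (by omega), if_pos rfl, if_neg (by omega)]; simp

theorem lof_ne (M i : ℕ) : lof M i ≠ 0 := by
  unfold lof; split_ifs <;> norm_num

theorem X_far (q : ℂ) (M N : ℕ) (i j : ℕ) (m n : ℤ) (h : i + 2 ≤ j ∨ j + 2 ≤ i) :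
    Commute (XpA q M N false 3 i m) (XpA q M N false 3 j n) := by
  unfold XpA XpF
  split_ifs with h1 h2
  · have hr := RingQuot.mkAlgHom_rel ℂ (rel.XX0p (q := q) (ext := false) (lvl := 3)
      ⟨i, h1⟩ ⟨j, h2⟩ m n (by norm_num) (cc_far M i j h))
    have hs : sgn M i j = 1 := by
      unfold sgn; rw [if_neg (by omega)]
    simp only [hs, one_smul, map_sub, map_mul, map_zero] at hr
    exact sub_eq_zero.mp hr
  all_goals simp

theorem X_adj (q : ℂ) (hq0 : q ≠ 0) (M N : ℕ) (i : ℕ) (m n : ℤ) (h1 : 1 ≤ i)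
    (h2 : i + 1 ≤ M + N - 1) :
    ∃ p : ℂ, p ≠ 0 ∧ XpA q M N false 3 (i + 1) (n + 1) * XpA q M N false 3 i m =
      p • (XpA q M N false 3 (i + 1) n * XpA q M N false 3 i (m + 1)) +
      p • (XpA q M N false 3 i m * XpA q M N false 3 (i + 1) (n + 1)) -
      XpA q M N false 3 i (m + 1) * XpA q M N false 3 (i + 1) n := by
  refine ⟨q ^ cc M i (i + 1), zpow_ne_zero _ hq0, ?_⟩
  unfold XpA XpF
  have hi : 1 ≤ i ∧ i ≤ M + N - 1 := by omega
  have hj : 1 ≤ i + 1 ∧ i + 1 ≤ M + N - 1 := by omega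
  rw [dif_pos hi, dif_pos hj, dif_pos hj, dif_pos hi]
  have hr := RingQuot.mkAlgHom_rel ℂ (rel.XXp (q := q) (ext := false) (lvl := 3)
      ⟨i, hi⟩ ⟨i + 1, hj⟩ m n (by norm_num)
      (by rw [cc_succ]; exact neg_ne_zero.mpr (lof_ne _ _)))
  simp only [map_sub, map_mul, map_smul] at hr
  unfold mkA
  rw [← sub_eq_zero] at hr ⊢
  rw [← hr]
  abel

abbrev wprod (q : ℂ) (M N : ℕ) (w : List (ℕ × ℤ)) : ALG q M N false 3 :=
  (w.map fun p => XpA q M N false 3 p.1 p.2).prod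

theorem word_comm (q : ℂ) (M N : ℕ) (k : ℕ) (m : ℤ) (w : List (ℕ × ℤ))
    (h : ∀ p ∈ w, p.1 + 2 ≤ k) :
    Commute (XpA q M N false 3 k m) (wprod q M N w) := by
  induction w with
  | nil => simp [wprod]
  | cons p w ih =>
    simp only [wprod, List.map_cons, List.prod_cons]
    exact (X_far q M N k p.1 m p.2 (Or.inr (h p (by simp)))).mul_right
      (ih fun p hp => h p (by simp [hp]))

theorem Xroot_comm (q : ℂ) (M N : ℕ) (k : ℕ) (m : ℤ) (i t : ℕ) (n : ℤ) (h : i + t + 2 ≤ k) :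
    Commute (XpA q M N false 3 k m) (Xroot q M N false 3 i t n) := by
  induction t with
  | zero => exact X_far q M N k i m n (Or.inr (by omega))
  | succ t ih =>
    simp only [Xroot, brF]
    have h1 := ih (by omega)
    have h2 := X_far q M N k (i + t + 1) m 0 (Or.inr (by omega))
    exact (h1.mul_right h2).sub_right ((h2.mul_right h1).smul_right _)

/-- consecutive products of root vectors whose supports tile `[a, c)`. -/
inductive PB (q : ℂ) (M N : ℕ) (a : ℕ) : ℕ → ALG q M N false 3 → Prop
  | one : PB q M N a a 1
  | snoc (c t : ℕ) (n : ℤ) (x : ALG q M N false 3) (h : PB q M N a c x) :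
      PB q M N a (c + t + 1) (x * Xroot q M N false 3 c t n)

theorem PB_comm (q : ℂ) (M N : ℕ) (a c : ℕ) (x : ALG q M N false 3) (h : PB q M N a c x)
    (k : ℕ) (m : ℤ) (hk : c + 1 ≤ k) : Commute (XpA q M N false 3 k m) x := by
  induction h with
  | one => exact Commute.one_right _
  | snoc c t n x _ ih =>
    exact (ih (by omega)).mul_right (Xroot_comm q M N k m c t n (by omega))

abbrev PBs (q : ℂ) (M N : ℕ) (a c : ℕ) : Submodule ℂ (ALG q M N false 3) :=
  Submodule.span ℂ {x | PB q M N a c x}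

theorem PBs_mulX (q : ℂ) (M N : ℕ) (a c : ℕ) (m : ℤ) (x : ALG q M N false 3)
    (h : x ∈ PBs q M N a c) : x * XpA q M N false 3 c m ∈ PBs q M N a (c + 1) := by
  induction h using Submodule.span_induction with
  | mem x hx => exact Submodule.subset_span (PB.snoc c 0 m x hx)
  | zero => simp
  | add x y _ _ hx hy => rw [add_mul]; exact add_mem hx hy
  | smul r x _ hx => rw [smul_mul_assoc]; exact Submodule.smul_mem _ _ hx

theorem PBs_X0mul (q : ℂ) (hq0 : q ≠ 0) (M N : ℕ) (a c : ℕ) (x : ALG q M N false 3)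
    (h : x ∈ PBs q M N a c) : XpA q M N false 3 c 0 * x ∈ PBs q M N a (c + 1) := by
  induction h using Submodule.span_induction with
  | mem x hx =>
    cases hx with
    | one => rw [mul_one, ← one_mul (XpA _ _ _ _ _ _ _)]
             exact Submodule.subset_span (PB.snoc a 0 0 1 PB.one)
    | snoc c t n y hy =>
      have hc := PB_comm q M N a c y hy (c + t + 1) 0 (by omega)
      have hu : qpar q M (c + t + 1) ≠ 0 := zpow_ne_zero _ hq0
      have key : XpA q M N false 3 (c + t + 1) 0 * (y * Xroot q M N false 3 c t n) =
          (qpar q M (c + t + 1))⁻¹ •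
            ((y * Xroot q M N false 3 c t n) * XpA q M N false 3 (c + t + 1) 0 -
              y * Xroot q M N false 3 c (t + 1) n) := by
        rw [← mul_assoc, hc.eq]
        simp only [Xroot, brF, mul_sub, mul_smul_comm, mul_assoc]
        rw [sub_sub_cancel, smul_smul, inv_mul_cancel₀ hu, one_smul]
      rw [key]
      refine Submodule.smul_mem _ _ (sub_mem ?_ ?_)
      · exact PBs_mulX q M N a _ 0 _ (Submodule.subset_span (PB.snoc c t n y hy))
      · exact Submodule.subset_span (PB.snoc c (t + 1) n y hy)
  | zero => simp
  | add x y _ _ hx hy => rw [mul_add]; exact add_mem hx hy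
  | smul r x _ hx => rw [mul_smul_comm]; exact Submodule.smul_mem _ _ hx

/-- `w` is a word of degree `α_a + ⋯ + α_{c-1}`. -/
def IsW (a c : ℕ) (w : List (ℕ × ℤ)) : Prop :=
  ∀ i : ℕ, (w.map Prod.fst).count i = if a ≤ i ∧ i < c then 1 else 0

theorem IsW.mem {a c : ℕ} {w : List (ℕ × ℤ)} (h : IsW a c w) (p : ℕ × ℤ) (hp : p ∈ w) :
    a ≤ p.1 ∧ p.1 < c := by
  by_contra hn
  have := h p.1
  rw [if_neg hn, List.count_eq_zero] at this
  exact this (List.mem_map_of_mem hp)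

theorem IsW.split {a c : ℕ} {w : List (ℕ × ℤ)} (h : IsW a c w) (k : ℕ) (hk : a ≤ k ∧ k < c) :
    ∃ w1 w2 n, w = w1 ++ (k, n) :: w2 ∧ (∀ p ∈ w1, p.1 ≠ k) ∧ (∀ p ∈ w2, p.1 ≠ k) := by
  have h1 := h k
  rw [if_pos hk] at h1
  have : k ∈ w.map Prod.fst := List.count_pos_iff.mp (by omega)
  obtain ⟨⟨k', n⟩, hp, rfl⟩ := List.mem_map.mp this
  obtain ⟨w1, w2, rfl⟩ := List.append_of_mem hp
  refine ⟨w1, w2, n, rfl, ?_, ?_⟩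
  all_goals
    simp only [List.map_append, List.map_cons, List.count_append, List.count_cons_self] at h1
    intro p hp he
    have := List.count_pos_iff.mpr (he ▸ List.mem_map_of_mem (f := Prod.fst) hp)
    simp only at this h1
    omega

theorem word_shift (q : ℂ) (hq0 : q ≠ 0) (M N : ℕ) (k : ℕ) (m n : ℤ) (w1 w2 : List (ℕ × ℤ))
    (h1 : 1 ≤ k) (h2 : k + 1 ≤ M + N - 1)
    (hw1 : ∀ p ∈ w1, p.1 + 1 ≤ k) (hw2 : ∀ p ∈ w2, p.1 + 1 ≤ k) :
    ∃ p : ℂ, p ≠ 0 ∧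
      XpA q M N false 3 (k + 1) (m + 1) * wprod q M N (w1 ++ (k, n) :: w2) =
      p • (XpA q M N false 3 (k + 1) m * wprod q M N (w1 ++ (k, n + 1) :: w2)) +
      p • (wprod q M N (w1 ++ (k, n) :: w2) * XpA q M N false 3 (k + 1) (m + 1)) -
      wprod q M N (w1 ++ (k, n + 1) :: w2) * XpA q M N false 3 (k + 1) m := by
  obtain ⟨p, hp, he⟩ := X_adj q hq0 M N k n m h1 h2
  refine ⟨p, hp, ?_⟩
  have c1 := fun m => word_comm q M N (k + 1) m w1 (fun p hp => by have := hw1 p hp; omega)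
  have c2 := fun m => word_comm q M N (k + 1) m w2 (fun p hp => by have := hw2 p hp; omega)
  have e : ∀ n, wprod q M N (w1 ++ (k, n) :: w2) =
      wprod q M N w1 * (XpA q M N false 3 k n * wprod q M N w2) := by
    intro n; simp [wprod]
  rw [e, e]
  generalize wprod q M N w1 = A at *
  generalize wprod q M N w2 = B at *
  have l : ∀ m n, XpA q M N false 3 (k + 1) m * (A * (XpA q M N false 3 k n * B)) =
      A * (XpA q M N false 3 (k + 1) m * XpA q M N false 3 k n) * B := by
    intro m n; rw [← mul_assoc, (c1 m).eq]; simp only [mul_assoc]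
  have r : ∀ m n, (A * (XpA q M N false 3 k n * B)) * XpA q M N false 3 (k + 1) m =
      A * (XpA q M N false 3 k n * XpA q M N false 3 (k + 1) m) * B := by
    intro m n; simp only [mul_assoc]; rw [(c2 m).eq]
  rw [l, l, r, r, he]
  simp only [mul_add, mul_sub, add_mul, sub_mul, mul_smul_comm, smul_mul_assoc]

theorem X_mul_word (q : ℂ) (hq0 : q ≠ 0) (M N : ℕ) (a k : ℕ) (ha : 1 ≤ a) (hak : a ≤ k)
    (hk : k + 1 ≤ M + N - 1)
    (ih : ∀ w, IsW a (k + 1) w → wprod q M N w ∈ PBs q M N a (k + 1)) (m : ℤ) :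
    ∀ w, IsW a (k + 1) w →
      XpA q M N false 3 (k + 1) m * wprod q M N w ∈ PBs q M N a (k + 1 + 1) := by
  have repl : ∀ (w1 w2 : List (ℕ × ℤ)) (n n' : ℤ), IsW a (k + 1) (w1 ++ (k, n) :: w2) →
      IsW a (k + 1) (w1 ++ (k, n') :: w2) := by
    intro w1 w2 n n' h i
    rw [← h i]; simp
  have bd : ∀ (w1 w2 : List (ℕ × ℤ)) (n : ℤ), IsW a (k + 1) (w1 ++ (k, n) :: w2) →
      (∀ p ∈ w1, p.1 ≠ k) → (∀ p ∈ w2, p.1 ≠ k) →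
      (∀ p ∈ w1, p.1 + 1 ≤ k) ∧ (∀ p ∈ w2, p.1 + 1 ≤ k) := by
    intro w1 w2 n h h1 h2
    constructor
    · intro p hp
      have := h.mem p (by simp [hp])
      have := h1 p hp
      omega
    · intro p hp
      have := h.mem p (by simp [hp])
      have := h2 p hp
      omega
  induction m using Int.induction_on with
  | zero => exact fun w hw => PBs_X0mul q hq0 M N a _ _ (ih w hw)
  | succ m hm =>
    intro w hw
    obtain ⟨w1, w2, n, rfl, h1, h2⟩ := hw.split k ⟨hak, by omega⟩
    obtain ⟨b1, b2⟩ := bd _ _ _ hw h1 h2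
    obtain ⟨p, hp, he⟩ := word_shift q hq0 M N k m n w1 w2 (by omega) hk b1 b2
    rw [he]
    have hw' := repl _ _ n (n + 1) hw
    exact sub_mem (add_mem (Submodule.smul_mem _ _ (hm _ hw'))
      (Submodule.smul_mem _ _ (PBs_mulX q M N a _ _ _ (ih _ hw))))
      (PBs_mulX q M N a _ _ _ (ih _ hw'))
  | pred m hm =>
    intro w hw
    obtain ⟨w1, w2, n, rfl, h1, h2⟩ := hw.split k ⟨hak, by omega⟩
    obtain ⟨b1, b2⟩ := bd _ _ _ hw h1 h2
    obtain ⟨p, hp, he⟩ := word_shift q hq0 M N k (-m - 1) (n - 1) w1 w2 (by omega) hk b1 b2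
    rw [sub_add_cancel, sub_add_cancel] at he
    have hw' := repl _ _ n (n - 1) hw
    have f1 := hm _ hw'
    have f2 := PBs_mulX q M N a _ (-m) _ (ih _ hw')
    have f3 := PBs_mulX q M N a _ (-m - 1) _ (ih _ hw)
    rw [← Submodule.smul_mem_iff _ hp]
    have e2 := (eq_sub_of_add_eq (eq_add_of_sub_eq he.symm))
    rw [e2]
    exact sub_mem (add_mem f1 f3) (Submodule.smul_mem _ _ f2)

theorem word_mem (q : ℂ) (hq0 : q ≠ 0) (M N : ℕ) (a : ℕ) (ha : 1 ≤ a) (t : ℕ) :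
    a + t ≤ M + N → ∀ w, IsW a (a + t) w → wprod q M N w ∈ PBs q M N a (a + t) := by
  induction t with
  | zero =>
    intro _ w hw
    have : w = [] := by
      apply List.eq_nil_iff_forall_not_mem.mpr
      intro p hp
      have := hw.mem p hp
      omega
    subst this
    exact Submodule.subset_span (by simpa [wprod] using PB.one)
  | succ t ih =>
    intro hb w hw
    obtain ⟨w1, w2, m, rfl, h1, h2⟩ := hw.split (a + t) ⟨by omega, by omega⟩
    have hw' : IsW a (a + t) (w1 ++ w2) := by
      intro i
      have := hw i
      simp only [List.map_append, List.map_cons, List.count_append, List.count_cons] at this ⊢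
      simp only [beq_iff_eq] at this
      split_ifs at this ⊢ <;> omega
    have ih' := ih (by omega)
    have e1 : wprod q M N (w1 ++ (a + t, m) :: w2) =
        wprod q M N w1 * (XpA q M N false 3 (a + t) m * wprod q M N w2) := by simp [wprod]
    have e2 : wprod q M N (w1 ++ w2) = wprod q M N w1 * wprod q M N w2 := by simp [wprod]
    by_cases hc : ∀ p ∈ w2, p.1 + 1 ≠ a + t
    · have c2 := word_comm q M N (a + t) m w2 (by
        intro p hp
        have := hw'.mem p (by simp [hp])
        have := hc p hp
        omega)
      rw [e1, c2.eq, ← mul_assoc, ← e2]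
      exact PBs_mulX q M N a _ m _ (ih' _ hw')
    · push Not at hc
      obtain ⟨p, hp, hpe⟩ := hc
      have hpm := hw'.mem p (by simp [hp])
      have c1 := word_comm q M N (a + t) m w1 (by
        intro r hr
        have h3 := hw'.mem r (by simp [hr])
        by_contra hlt
        have hrp : r.1 = p.1 := by omega
        have h4 := hw' p.1
        rw [if_pos hpm] at h4
        simp only [List.map_append, List.count_append] at h4
        have h5 := List.count_pos_iff.mpr (List.mem_map_of_mem (f := Prod.fst) hp)
        have h6 := List.count_pos_iff.mpr (List.mem_map_of_mem (f := Prod.fst) hr)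
        rw [hrp] at h6
        omega)
      rw [e1, ← mul_assoc, ← c1.eq, mul_assoc, ← e2]
      obtain ⟨s, rfl⟩ : ∃ s, t = s + 1 := ⟨t - 1, by omega⟩
      exact X_mul_word q hq0 M N a (a + s) ha (by omega) (by omega) ih' m _ hw'

theorem PB_list (q : ℂ) (M N : ℕ) (a c : ℕ) (ha : 1 ≤ a) (x : ALG q M N false 3)
    (h : PB q M N a c x) : c ≤ M + N → a ≤ c ∧ ∃ L : List ((ℕ × ℕ) × ℤ),
      (∀ p ∈ L, 1 ≤ p.1.1 ∧ p.1.1 ≤ p.1.2 ∧ p.1.2 < c) ∧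
      L.Chain' (fun a b => rootLE a.1 b.1) ∧
      (∀ i : ℕ, ((L.map fun p => if p.1.1 ≤ i ∧ i ≤ p.1.2 then 1 else 0).sum) =
        if a ≤ i ∧ i < c then 1 else 0) ∧
      x = (L.map fun p => XrootIJ q M N false 3 p.1.1 p.1.2 p.2).prod := by
  induction h with
  | one =>
    intro _
    refine ⟨le_rfl, [], by simp, by simp [List.Chain'], ?_, by simp⟩
    intro i
    rw [if_neg (by omega)]; simp
  | snoc c t n x _ ih =>
    intro hc
    obtain ⟨hac, L, h1, h2, h3, h4⟩ := ih (by omega)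
    refine ⟨by omega, L ++ [((c, c + t), n)], ?_, ?_, ?_, ?_⟩
    · intro p hp
      rw [List.mem_append, List.mem_singleton] at hp
      rcases hp with hp | rfl
      · have := h1 p hp; omega
      · simp only; omega
    · refine List.isChain_append.mpr ⟨h2, List.isChain_singleton _, ?_⟩
      intro p hp r hr
      simp only [List.head?_cons, Option.mem_def, Option.some.injEq] at hr
      subst hr
      have := h1 p (List.mem_of_mem_getLast? hp)
      left; simp only; omega
    · intro i
      rw [List.map_append, List.sum_append, h3 i]
      simp only [List.map_cons, List.map_nil, List.sum_cons, List.sum_nil]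
      split_ifs <;> omega
    · simp [h4, XrootIJ]

abbrev WS (q : ℂ) (M N : ℕ) (d : ℕ → ℕ) : Submodule ℂ (ALG q M N false 3) :=
  Submodule.span ℂ (wordDegSet q M N false 3 d)

theorem WS_mul (q : ℂ) (M N : ℕ) (d e : ℕ → ℕ) (x y : ALG q M N false 3)
    (hx : x ∈ WS q M N d) (hy : y ∈ WS q M N e) : x * y ∈ WS q M N (fun i => d i + e i) := by
  have h := Submodule.mul_mem_mul hx hy
  rw [Submodule.span_mul_span] at h
  refine Submodule.span_mono ?_ h
  rintro _ ⟨x, ⟨w, h1, h2, rfl⟩, y, ⟨v, h3, h4, rfl⟩, rfl⟩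
  refine ⟨w ++ v, ?_, ?_, by simp⟩
  · intro p hp
    rcases List.mem_append.mp hp with hp | hp
    · exact h1 p hp
    · exact h3 p hp
  · intro i
    rw [List.map_append, List.count_append, h2, h4]

theorem X_WS (q : ℂ) (M N : ℕ) (i : ℕ) (n : ℤ) (h : 1 ≤ i ∧ i ≤ M + N - 1) :
    XpA q M N false 3 i n ∈ WS q M N (fun k => if i ≤ k ∧ k ≤ i then 1 else 0) := by
  refine Submodule.subset_span ⟨[(i, n)], ?_, ?_, by simp⟩
  · intro p hp
    rw [List.mem_singleton] at hp
    subst hp; exact h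
  · intro k
    simp only [List.map_cons, List.map_nil, List.count_singleton, beq_iff_eq]
    split_ifs <;> omega

theorem Xroot_WS (q : ℂ) (M N : ℕ) (i t : ℕ) (n : ℤ) (h : 1 ≤ i ∧ i + t ≤ M + N - 1) :
    Xroot q M N false 3 i t n ∈ WS q M N (fun k => if i ≤ k ∧ k ≤ i + t then 1 else 0) := by
  induction t with
  | zero => exact X_WS q M N i n h
  | succ t ih =>
    have h1 := ih (by omega)
    have h2 := X_WS q M N (i + t + 1) 0 (by omega)
    have a1 := WS_mul q M N _ _ _ _ h1 h2
    have a2 := WS_mul q M N _ _ _ _ h2 h1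
    simp only [Xroot, brF]
    refine sub_mem ?_ (Submodule.smul_mem _ _ ?_)
    · convert a1 using 3
      split_ifs <;> omega
    · convert a2 using 3
      split_ifs <;> omega

theorem list_WS (q : ℂ) (M N : ℕ) (L : List ((ℕ × ℕ) × ℤ))
    (h : ∀ p ∈ L, 1 ≤ p.1.1 ∧ p.1.1 ≤ p.1.2 ∧ p.1.2 ≤ M + N - 1) :
    (L.map fun p => XrootIJ q M N false 3 p.1.1 p.1.2 p.2).prod ∈
      WS q M N (fun i => (L.map fun p => if p.1.1 ≤ i ∧ i ≤ p.1.2 then 1 else 0).sum) := by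
  induction L with
  | nil => exact Submodule.subset_span ⟨[], by simp, by simp, by simp⟩
  | cons p L ih =>
    simp only [List.map_cons, List.prod_cons, List.sum_cons]
    refine WS_mul q M N _ _ _ _ ?_ (ih fun p hp => h p (by simp [hp]))
    have hp := h p (by simp)
    have := Xroot_WS q M N p.1.1 (p.1.2 - p.1.1) p.2 (by omega)
    rw [show p.1.1 + (p.1.2 - p.1.1) = p.1.2 by omega] at this
    exact this

end QAS

open QAS in
/-- Proposition 3.8: for every `β = α_a + ⋯ + α_b ∈ Δ`, the degree-`β`
homogeneous component of `U⁺` (the span of words in the `X⁺_{i,n}` of degree `β`) equals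
the span of the PBW ordered monomials in the root vectors of total degree `β`. -/
theorem pbw_on_roots (q : ℂ) (hq0 : q ≠ 0)
    (hq1 : ∀ k : ℕ, k ≠ 0 → q ^ k ≠ 1) (M N : ℕ) (hM : 1 ≤ M) (hN : 1 ≤ N) :
    ∀ a b : ℕ, 1 ≤ a → a ≤ b → b ≤ M + N - 1 →
      Submodule.span ℂ
          (wordDegSet q M N false 3 (fun i => if a ≤ i ∧ i ≤ b then 1 else 0)) =
        Submodule.span ℂ
          (pbwDegSet q M N false 3 (fun i => if a ≤ i ∧ i ≤ b then 1 else 0)) := by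
  intro a b ha hab hb
  apply le_antisymm
  · rw [Submodule.span_le]
    rintro x ⟨w, hw1, hw2, rfl⟩
    have hw : IsW a (a + (b + 1 - a)) w := by
      intro i
      rw [hw2 i]
      beta_reduce; split_ifs <;> omega
    have hm := word_mem q hq0 M N a ha (b + 1 - a) (by omega) w hw
    refine Submodule.span_mono ?_ hm
    intro x hx
    obtain ⟨_, L, h1, h2, h3, h4⟩ := PB_list q M N a _ ha x hx (by omega)
    refine ⟨L, ?_, h2, ?_, h4⟩
    · intro p hp
      have := h1 p hp
      omega
    · intro i
      rw [h3 i]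
      beta_reduce; split_ifs <;> omega
  · rw [Submodule.span_le]
    rintro x ⟨L, h1, h2, h3, rfl⟩
    have := list_WS q M N L h1
    simp only [h3] at this
    exact this
end
end

section
/- Suppose M, N ≥ 1 with MN > 0. The assignment K_i ↦ K̄_{M+N−i}^{−1}, X⁺_{i,n} ↦ X̄⁺_{M+N−i,−n}, X⁻_{i,n} ↦ (−1)^{p(α_i)} X̄⁻_{M+N−i,−n}, h_{i,s} ↦ (−1)^{p(α_i)} h̄_{M+N−i,−s} (for 1 ≤ i ≤ M+N−1, n ∈ ℤ, s ∈ ℤ∖{0}) extends to an isomorphism of superalgebras π_{M,N} : U_q(Lsl(M,N)) → U_q(Lsl(N,M)), where p(α_i) = 1 if i = M and p(α_i) = 0 otherwise, and barred symbols denote the corresponding generators of U_q(Lsl(N,M)). -/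
noncomputable section

namespace QAS

/-! ### The flip isomorphism -/

lemma lof_flip (M N a : ℕ) (h1 : 1 ≤ a) (h2 : a ≤ M + N) :
    lof N (M + N + 1 - a) = - lof M a := by
  unfold lof; split_ifs <;> first | omega | rfl

lemma innerE_flip (M N a b : ℕ) (h1 : 1 ≤ a) (h2 : a ≤ M + N) (h3 : 1 ≤ b) (h4 : b ≤ M + N) :
    innerE N (M + N + 1 - a) (M + N + 1 - b) = - innerE M a b := by
  unfold innerE
  rw [lof_flip M N a h1 h2]
  split_ifs <;> first | omega | rfl

/-- the reflected index. -/
def fl {M N : ℕ} (i : Idx M N) : Idx N M :=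
  ⟨M + N - i.1, by have := i.2; omega, by have := i.2; omega⟩

lemma fl_fl {M N : ℕ} (i : Idx M N) : fl (fl i) = i := by
  apply Subtype.ext
  have := i.2
  show N + M - (M + N - i.1) = i.1
  omega

lemma fl_inj {M N : ℕ} {i j : Idx M N} : fl i = fl j ↔ i = j :=
  ⟨fun h => by rw [← fl_fl i, h, fl_fl], fun h => by rw [h]⟩

lemma fl_eq {M N : ℕ} (i : Idx M N) : (fl i).1 = N ↔ i.1 = M := by
  have := i.2
  show M + N - i.1 = N ↔ _
  omega

lemma cc_fl {M N : ℕ} (i j : Idx M N) : cc N (fl i).1 (fl j).1 = - cc M i.1 j.1 := by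
  have hi := i.2
  have hj := j.2
  have e1 : (fl i).1 = M + N + 1 - (i.1 + 1) := by show M + N - i.1 = _; omega
  have e2 : (fl i).1 + 1 = M + N + 1 - i.1 := by show M + N - i.1 + 1 = _; omega
  have e3 : (fl j).1 = M + N + 1 - (j.1 + 1) := by show M + N - j.1 = _; omega
  have e4 : (fl j).1 + 1 = M + N + 1 - j.1 := by show M + N - j.1 + 1 = _; omega
  unfold cc form4
  rw [e2, e4, e1, e3]
  rw [innerE_flip, innerE_flip, innerE_flip, innerE_flip] <;> first | omega | skip

lemma sgn_fl {M N : ℕ} (i j : Idx M N) : sgn N (fl i).1 (fl j).1 = sgn M i.1 j.1 := by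
  unfold sgn
  simp only [fl_eq]

/-- `(-1)^{p(α_i)}`. -/
def sg (M i : ℕ) : ℂ := if i = M then -1 else 1

lemma sg_fl {M N : ℕ} (i : Idx M N) : sg N (fl i).1 = sg M i.1 := by
  unfold sg
  simp only [fl_eq]

lemma sg_sq (M i : ℕ) : sg M i * sg M i = 1 := by
  unfold sg; split_ifs <;> norm_num

lemma lof_fl {M N : ℕ} (i : Idx M N) : (lof N (fl i).1 : ℤ) =
    if i.1 = M then lof M i.1 else - lof M i.1 := by
  have := i.2
  unfold lof fl
  dsimp only
  split_ifs <;> first | omega | rfl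

lemma qpar_fl (q : ℂ) {M N : ℕ} (i : Idx M N) :
    qpar q N (fl i).1 - (qpar q N (fl i).1)⁻¹ =
      - (sg M i.1 * (qpar q M i.1 - (qpar q M i.1)⁻¹)) := by
  unfold qpar sg
  rw [lof_fl]
  split_ifs
  · ring
  · rw [zpow_neg, inv_inv]; ring

lemma qint_neg (v : ℂ) (m : ℤ) : qint v (-m) = - qint v m := by
  unfold qint; rw [neg_neg]; ring

lemma qint_inv (v : ℂ) (m : ℤ) : qint v⁻¹ m = qint v m := by
  unfold qint
  rw [inv_inv, inv_zpow', inv_zpow', neg_neg, ← neg_sub v, ← neg_sub (v ^ m), neg_div_neg_eq]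

lemma qint_fl (q : ℂ) {M N : ℕ} (i j : Idx M N) (s : ℤ) :
    sg M i.1 * (qint (qpar q N (fl i).1) (-s * lof N (fl i).1 * cc N (fl i).1 (fl j).1)
      / ((-s : ℤ) : ℂ)) =
    qint (qpar q M i.1) (s * lof M i.1 * cc M i.1 j.1) / (s : ℂ) := by
  rw [cc_fl]
  unfold sg qpar
  rw [lof_fl]
  split_ifs
  · rw [show -s * lof M i.1 * -cc M i.1 j.1 = s * lof M i.1 * cc M i.1 j.1 by ring]
    push_cast
    rw [div_neg]; ring
  · rw [show -s * -lof M i.1 * -cc M i.1 j.1 = -(s * lof M i.1 * cc M i.1 j.1) by ring,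
      zpow_neg, qint_inv, qint_neg]
    push_cast
    rw [neg_div_neg_eq, one_mul]

lemma expC_map {A B : Type} [Ring A] [Algebra ℂ A] [Ring B] [Algebra ℂ B] (f : A →ₐ[ℂ] B)
    (t c : ℂ) (a : ℕ → A) (b : ℕ → B)
    (hab : ∀ s, f (a (s + 1)) = c • b (s + 1)) (n : ℕ) :
    f (expC t a n) = expC (t * c) b n := by
  induction n using Nat.strong_induction_on with
  | _ n ih =>
    cases n with
    | zero => simp [expC]
    | succ n =>
      rw [expC, expC, map_smul, map_smul, map_sum, mul_smul, Finset.smul_sum (r := c)]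
      congr 2
      apply Finset.sum_congr rfl
      intro s hs
      rw [map_smul, map_mul, hab, ih (n - s) (by omega), smul_mul_assoc, smul_comm]

section flip

variable (q : ℂ) (M N : ℕ)

/-- images of the generators -/
def flipG : Gen M N false → ALG q N M false 3
  | Gen.Xp i n => mkA q N M false 3 (gi (Gen.Xp (fl i) (-n)))
  | Gen.Xm i n => sg M i.1 • mkA q N M false 3 (gi (Gen.Xm (fl i) (-n)))
  | Gen.K i => mkA q N M false 3 (gi (Gen.Ki (fl i)))
  | Gen.Ki i => mkA q N M false 3 (gi (Gen.K (fl i)))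
  | Gen.H i s => sg M i.1 • mkA q N M false 3
      (gi (Gen.H (fl i) ⟨-s.1, neg_ne_zero.mpr s.2⟩))
  | Gen.K0 h => absurd h (by decide)
  | Gen.K0i h => absurd h (by decide)

/-- the flip on the free algebra -/
def flipF : FA M N false →ₐ[ℂ] ALG q N M false 3 := FreeAlgebra.lift ℂ (flipG q M N)

lemma flipF_gi (g : Gen M N false) : flipF q M N (gi g) = flipG q M N g := by
  unfold flipF gi; exact FreeAlgebra.lift_ι_apply _ _

lemma mk_rel {a b : FA N M false} (h : rel q N M false 3 a b) :
    mkA q N M false 3 a = mkA q N M false 3 b := RingQuot.mkAlgHom_rel ℂ h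

lemma flipF_HF (i : Idx M N) (s : ℤ) :
    flipF q M N (HF M N false i.1 s) =
      sg M i.1 • mkA q N M false 3 (HF N M false (fl i).1 (-s)) := by
  unfold HF
  by_cases hs : s = 0
  · simp [hs]
  · rw [dif_pos ⟨i.2, hs⟩, dif_pos ⟨(fl i).2, neg_ne_zero.mpr hs⟩, flipF_gi]
    rfl

lemma flipF_phiP (i : Idx M N) (n : ℤ) :
    flipF q M N (phiPF q M N false i.1 n) =
      mkA q N M false 3 (phiMF q N M false (fl i).1 (-n)) := by
  unfold phiPF phiMF
  by_cases hn : 0 ≤ n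
  · rw [if_pos hn, if_pos (by omega), map_mul, map_mul, neg_neg]
    congr 1
    · unfold KF KiF
      rw [dif_pos i.2, dif_pos (fl i).2, flipF_gi]; rfl
    · rw [expC_map (flipF q M N) _ (sg M i.1) _
        (fun s => mkA q N M false 3 (HF N M false (fl i).1 (-(s : ℤ))))
        (fun s => flipF_HF q M N i _),
        expC_map (mkA q N M false 3) _ 1 _
        (fun s => mkA q N M false 3 (HF N M false (fl i).1 (-(s : ℤ))))
        (fun s => by rw [one_smul]), qpar_fl]
      congr 1
      ring
  · rw [if_neg hn, if_neg (by omega), map_zero, map_zero]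

lemma flipF_phiM (i : Idx M N) (n : ℤ) :
    flipF q M N (phiMF q M N false i.1 n) =
      mkA q N M false 3 (phiPF q N M false (fl i).1 (-n)) := by
  unfold phiPF phiMF
  by_cases hn : n ≤ 0
  · rw [if_pos hn, if_pos (by omega), map_mul, map_mul]
    congr 1
    · unfold KF KiF
      rw [dif_pos i.2, dif_pos (fl i).2, flipF_gi]; rfl
    · rw [expC_map (flipF q M N) _ (sg M i.1) _
        (fun s => mkA q N M false 3 (HF N M false (fl i).1 (s : ℤ)))
        (fun s => by rw [flipF_HF q M N i, neg_neg]),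
        expC_map (mkA q N M false 3) _ 1 _
        (fun s => mkA q N M false 3 (HF N M false (fl i).1 (s : ℤ)))
        (fun s => by rw [one_smul]), qpar_fl]
      congr 1
      ring
  · rw [if_neg hn, if_neg (by omega), map_zero, map_zero]

/-- if `K K' = 1 = K' K` and `K X = c X K` then `K' X = c⁻¹ X K'` -/
lemma inv_comm {A : Type} [Ring A] [Algebra ℂ A] (k k' x : A) (c : ℂ) (hc : c ≠ 0)
    (h1 : k * k' = 1) (h2 : k' * k = 1) (h : k * x = c • (x * k)) :
    k' * x = c⁻¹ • (x * k') := by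
  have h3 : k' * (k * x) * k' = c • (k' * (x * k) * k') := by
    rw [h, mul_smul_comm, smul_mul_assoc]
  rw [← mul_assoc, h2, one_mul, mul_assoc, mul_assoc, h1, mul_one] at h3
  rw [h3, smul_smul, inv_mul_cancel₀ hc, one_smul]

lemma map_brF {A B : Type} [Ring A] [Algebra ℂ A] [Ring B] [Algebra ℂ B] (f : A →ₐ[ℂ] B)
    (u : ℂ) (x y : A) : f (brF u x y) = brF u (f x) (f y) := by
  simp [brF]

lemma brF_smul {A : Type} [Ring A] [Algebra ℂ A]
    (u a b : ℂ) (x y : A) : brF u (a • x) (b • y) = (a * b) • brF u x y := by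
  unfold brF
  simp only [smul_mul_smul_comm, smul_sub, mul_comm b a, smul_comm u]

lemma osc_swap {A : Type} [Ring A] [Algebra ℂ A] (q : ℂ) (hq : q ≠ 0) (a b x : A)
    (h : a * b = b * a) :
    brF q (brF q⁻¹ a x) b = brF q (brF q⁻¹ b x) a := by
  unfold brF
  simp only [sub_mul, mul_sub, smul_sub, smul_mul_assoc, mul_smul_comm, smul_smul,
    mul_inv_cancel₀ hq, one_smul, ← mul_assoc]
  rw [h, mul_assoc x a b, h, ← mul_assoc]
  abel

lemma cc_zero (N : ℕ) (hN : 1 < N) : cc N (N - 1) (N + 1) = 0 := by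
  unfold cc form4 innerE
  split_ifs <;> first | omega | rfl

lemma flipF_XpF (i : ℕ) (h : 1 ≤ i ∧ i ≤ M + N - 1) (n : ℤ) :
    flipF q M N (XpF M N false i n) = XpA q N M false 3 (M + N - i) (-n) := by
  unfold XpF XpA XpF
  rw [dif_pos h, dif_pos (show 1 ≤ M + N - i ∧ M + N - i ≤ N + M - 1 by omega),
    flipF_gi]
  rfl

lemma flipF_XmF (i : ℕ) (h : 1 ≤ i ∧ i ≤ M + N - 1) (n : ℤ) :
    flipF q M N (XmF M N false i n) = sg M i • XmA q N M false 3 (M + N - i) (-n) := by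
  unfold XmF XmA XmF
  rw [dif_pos h, dif_pos (show 1 ≤ M + N - i ∧ M + N - i ≤ N + M - 1 by omega),
    flipF_gi]
  rfl

lemma flipF_KF (i : ℕ) (h : 1 ≤ i ∧ i ≤ M + N - 1) :
    flipF q M N (KF M N false i) = KiA q N M false 3 (M + N - i) := by
  unfold KF KiA KiF
  rw [dif_pos h, dif_pos (show 1 ≤ M + N - i ∧ M + N - i ≤ N + M - 1 by omega),
    flipF_gi]
  rfl

lemma map_oscOf {A B : Type} [Ring A] [Algebra ℂ A] [Ring B] [Algebra ℂ B] (f : A →ₐ[ℂ] B)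
    (X : ℕ → ℤ → A) (m n k u : ℤ) :
    f (oscOf q M X m n k u) = oscOf q M (fun i n => f (X i n)) m n k u := by
  simp only [oscOf, map_add, map_mul, map_brF]

lemma flip_osc {A B : Type} [Ring A] [Algebra ℂ A] [Ring B] [Algebra ℂ B] (f : A →ₐ[ℂ] B)
    (hq : q ≠ 0) (c : ℂ)
    (X : ℕ → ℤ → A) (Y : ℕ → ℤ → B)
    (hA : ∀ n, f (X (M - 1) n) = Y (N + 1) (-n))
    (hX : ∀ n, f (X M n) = c • Y N (-n))
    (hB : ∀ n, f (X (M + 1) n) = Y (N - 1) (-n))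
    (hcomm : ∀ m n, Y (N - 1) m * Y (N + 1) n = Y (N + 1) n * Y (N - 1) m)
    (m n k u : ℤ) :
    f (oscOf q M X m n k u) = (c * c) • oscOf q N Y (-k) (-n) (-m) (-u) := by
  rw [map_oscOf]
  unfold oscOf
  dsimp only
  have e : ∀ a b x : B, brF q (brF q⁻¹ a (c • x)) b = c • brF q (brF q⁻¹ a x) b := by
    intro a b x
    have h1 := brF_smul q⁻¹ 1 c a x
    have h2 := brF_smul q c 1 (brF q⁻¹ a x) b
    rw [one_smul, one_mul] at h1
    rw [one_smul, mul_one] at h2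
    rw [h1, h2]
  rw [hA, hX, hX, hB, e, osc_swap q hq _ _ _ (hcomm _ _).symm]
  simp only [smul_mul_smul_comm, smul_add]

lemma XpA_comm (hM : 1 < M) (hN : 1 < N) (m n : ℤ) :
    XpA q N M false 3 (N - 1) m * XpA q N M false 3 (N + 1) n =
      XpA q N M false 3 (N + 1) n * XpA q N M false 3 (N - 1) m := by
  have h1 : 1 ≤ N - 1 ∧ N - 1 ≤ N + M - 1 := by omega
  have h2 : 1 ≤ N + 1 ∧ N + 1 ≤ N + M - 1 := by omega
  have h := mk_rel q M N (rel.XX0p (q := q) (ext := false) (lvl := 3)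
    (⟨N - 1, h1⟩ : Idx N M) ⟨N + 1, h2⟩ m n (by norm_num) (cc_zero N hN))
  rw [show sgn N (N - 1) (N + 1) = 1 from if_neg (by omega), one_smul, map_sub, map_mul,
    map_mul, map_zero, sub_eq_zero] at h
  unfold XpA XpF
  rw [dif_pos h1, dif_pos h2]
  exact h

lemma XmA_comm (hM : 1 < M) (hN : 1 < N) (m n : ℤ) :
    XmA q N M false 3 (N - 1) m * XmA q N M false 3 (N + 1) n =
      XmA q N M false 3 (N + 1) n * XmA q N M false 3 (N - 1) m := by
  have h1 : 1 ≤ N - 1 ∧ N - 1 ≤ N + M - 1 := by omega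
  have h2 : 1 ≤ N + 1 ∧ N + 1 ≤ N + M - 1 := by omega
  have h := mk_rel q M N (rel.XX0m (q := q) (ext := false) (lvl := 3)
    (⟨N - 1, h1⟩ : Idx N M) ⟨N + 1, h2⟩ m n (by norm_num) (cc_zero N hN))
  rw [show sgn N (N - 1) (N + 1) = 1 from if_neg (by omega), one_smul, map_sub, map_mul,
    map_mul, map_zero, sub_eq_zero] at h
  unfold XmA XmF
  rw [dif_pos h1, dif_pos h2]
  exact h

/-- reversal of the quadratic relation. -/
lemma quad_flip {A : Type} [Ring A] [Algebra ℂ A] (c : ℂ) (hc : c ≠ 0) (x1 x0 y1 y0 : A)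
    (h : x1 * y0 - c⁻¹ • (y0 * x1) = c⁻¹ • (x0 * y1) - y1 * x0) :
    x0 * y1 - c • (y1 * x0) = c • (x1 * y0) - y0 * x1 := by
  have h' := congrArg (fun z => c • z) h
  simp only [smul_sub, smul_smul, mul_inv_cancel₀ hc, one_smul] at h'
  exact h'.symm

lemma quad_smul {A : Type} [Ring A] [Algebra ℂ A] (a b c : ℂ) (x1 x0 y1 y0 : A)
    (h : x1 * y0 - c • (y0 * x1) = c • (x0 * y1) - y1 * x0) :
    (a • x1) * (b • y0) - c • ((b • y0) * (a • x1)) =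
      c • ((a • x0) * (b • y1)) - (b • y1) * (a • x0) := by
  have h' := congrArg (fun z => (a * b) • z) h
  simp only [smul_sub] at h'
  simp only [smul_mul_smul_comm, mul_comm b a, smul_comm c]
  exact h'

lemma smul_sub_of {A : Type} [Ring A] [Algebra ℂ A] (c : ℂ) {x y z : A} (h : x - y = z) :
    c • x - c • y = c • z := by
  rw [← smul_sub, h]

lemma smul_sub_swap {A : Type} [Ring A] [Algebra ℂ A] {c d : ℂ} (h : c = -d) (x y : A) :
    c • (x - y) = d • (y - x) := by
  rw [h, neg_smul, ← smul_neg, neg_sub]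

lemma flip_rel (hq0 : q ≠ 0) {a b : FA M N false} (h : rel q M N false 3 a b) :
    flipF q M N a = flipF q M N b := by
  cases h with
  | KKi i =>
    simpa only [map_mul, map_one, flipF_gi, flipG] using mk_rel q M N (rel.KiK (fl i))
  | KiK i =>
    simpa only [map_mul, map_one, flipF_gi, flipG] using mk_rel q M N (rel.KKi (fl i))
  | KK i j =>
    simpa only [map_mul, flipF_gi, flipG] using mk_rel q M N (rel.KiKi (fl i) (fl j))
  | KKi2 i j =>
    simpa only [map_mul, flipF_gi, flipG] using (mk_rel q M N (rel.KKi2 (fl j) (fl i))).symm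
  | KiKi i j =>
    simpa only [map_mul, flipF_gi, flipG] using mk_rel q M N (rel.KK (fl i) (fl j))
  | KH i j s =>
    have h := mk_rel q M N (rel.KiH (fl i) (fl j) ⟨-s.1, neg_ne_zero.mpr s.2⟩)
    simp only [map_mul] at h
    simp only [map_mul, flipF_gi, flipG, mul_smul_comm, smul_mul_assoc, h]
  | KiH i j s =>
    have h := mk_rel q M N (rel.KH (fl i) (fl j) ⟨-s.1, neg_ne_zero.mpr s.2⟩)
    simp only [map_mul] at h
    simp only [map_mul, flipF_gi, flipG, mul_smul_comm, smul_mul_assoc, h]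
  | HH i j s t =>
    have h := mk_rel q M N (rel.HH (fl i) (fl j) ⟨-s.1, neg_ne_zero.mpr s.2⟩
      ⟨-t.1, neg_ne_zero.mpr t.2⟩)
    simp only [map_mul] at h
    simp only [map_mul, flipF_gi, flipG, smul_mul_smul_comm, h, mul_comm (sg M i.1)]
  | KXp i j n =>
    have h := mk_rel q M N (rel.KXp (fl i) (fl j) (-n))
    have h1 := mk_rel q M N (rel.KKi (fl i))
    have h2 := mk_rel q M N (rel.KiK (fl i))
    simp only [map_mul, map_smul, map_one] at h h1 h2
    have h3 := inv_comm _ _ _ _ (zpow_ne_zero _ hq0) h1 h2 h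
    rw [cc_fl, ← zpow_neg, neg_neg] at h3
    simp only [map_mul, map_smul, flipF_gi, flipG, h3]
  | KXm i j n =>
    have h := mk_rel q M N (rel.KXm (fl i) (fl j) (-n))
    have h1 := mk_rel q M N (rel.KKi (fl i))
    have h2 := mk_rel q M N (rel.KiK (fl i))
    simp only [map_mul, map_smul, map_one] at h h1 h2
    have h3 := inv_comm _ _ _ _ (zpow_ne_zero _ hq0) h1 h2 h
    rw [cc_fl, ← zpow_neg, neg_neg] at h3
    simp only [map_mul, map_smul, flipF_gi, flipG, mul_smul_comm, smul_mul_assoc, h3]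
    rw [smul_comm]
  | HXp i j s n =>
    have h := mk_rel q M N (rel.HXp (fl i) (fl j) ⟨-s.1, neg_ne_zero.mpr s.2⟩ (-n))
    simp only [map_mul, map_smul, map_sub] at h
    simp only [map_mul, map_smul, map_sub, flipF_gi, flipG, mul_smul_comm, smul_mul_assoc]
    refine (smul_sub_of _ h).trans ?_
    rw [smul_smul, qint_fl, neg_add]
  | HXm i j s n =>
    have h := mk_rel q M N (rel.HXm (fl i) (fl j) ⟨-s.1, neg_ne_zero.mpr s.2⟩ (-n))
    simp only [map_mul, map_smul, map_sub, map_neg] at h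
    simp only [map_mul, map_smul, map_sub, map_neg, flipF_gi, flipG, mul_smul_comm,
      smul_mul_assoc]
    rw [smul_comm (sg M j.1) (sg M i.1)]
    refine (smul_sub_of _ (smul_sub_of _ h)).trans ?_
    rw [smul_comm (sg M i.1), smul_neg, smul_smul, qint_fl, neg_add, smul_neg, smul_comm]
  | XpXm i j m n =>
    have h := mk_rel q M N (rel.XpXm (fl i) (fl j) (-m) (-n))
    simp only [map_mul, map_smul, map_sub] at h
    simp only [map_mul, map_smul, map_sub, flipF_gi, flipG, mul_smul_comm, smul_mul_assoc]
    rw [smul_comm (sgn M i.1 j.1), ← sgn_fl]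
    refine (smul_sub_of _ h).trans ?_
    by_cases hij : i = j
    · subst hij
      simp only [if_true, map_smul, map_sub]
      rw [flipF_phiP, flipF_phiM, qpar_fl, neg_add, smul_smul]
      refine smul_sub_swap ?_ _ _
      have := sg_sq M i.1
      have h0 : sg M i.1 ≠ 0 := fun h0 => by rw [h0] at this; norm_num at this
      rw [inv_neg, mul_inv, mul_neg, ← mul_assoc, mul_inv_cancel₀ h0, one_mul]
    · rw [if_neg hij, if_neg (fun e => hij (fl_inj.mp e)), map_zero, map_zero, smul_zero]
  | XX0p i j m n h2 h =>
    have h := mk_rel q M N (rel.XX0p (fl i) (fl j) (-m) (-n) h2 (by rw [cc_fl, h, neg_zero]))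
    rw [sgn_fl] at h
    simp only [map_mul, map_smul, map_sub, map_zero] at h
    simp only [map_mul, map_smul, map_sub, map_zero, flipF_gi, flipG, h]
  | XX0m i j m n h2 h =>
    have h := mk_rel q M N (rel.XX0m (fl i) (fl j) (-m) (-n) h2 (by rw [cc_fl, h, neg_zero]))
    rw [sgn_fl] at h
    simp only [map_mul, map_smul, map_sub, map_zero] at h
    simp only [map_mul, map_smul, map_sub, map_zero, flipF_gi, flipG, smul_mul_smul_comm]
    rw [smul_comm (sgn M i.1 j.1), mul_comm (sg M j.1)]
    exact (smul_sub_of _ h).trans (smul_zero _)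
  | XXp i j m n h2 h =>
    have h := mk_rel q M N (rel.XXp (fl i) (fl j) (-(m + 1)) (-(n + 1)) h2
      (by rw [cc_fl]; exact neg_ne_zero.mpr h))
    rw [cc_fl, zpow_neg, show -(m + 1) + 1 = -m by ring, show -(n + 1) + 1 = -n by ring] at h
    simp only [map_mul, map_smul, map_sub] at h
    simp only [map_mul, map_smul, map_sub, flipF_gi, flipG]
    exact quad_flip _ (zpow_ne_zero _ hq0) _ _ _ _ h
  | XXm i j m n h2 h =>
    have h := mk_rel q M N (rel.XXm (fl i) (fl j) (-(m + 1)) (-(n + 1)) h2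
      (by rw [cc_fl]; exact neg_ne_zero.mpr h))
    rw [cc_fl, zpow_neg, show -(m + 1) + 1 = -m by ring, show -(n + 1) + 1 = -n by ring] at h
    simp only [map_mul, map_smul, map_sub] at h
    simp only [map_mul, map_smul, map_sub, flipF_gi, flipG]
    exact quad_smul _ _ _ _ _ _ _ (quad_flip _ (zpow_ne_zero _ (hq0)) _ _ _ _ h)
  | serreP i j m n k h3 h hi =>
    have h := mk_rel q M N (rel.serreP (fl i) (fl j) (-m) (-n) (-k) h3
      (by rw [cc_fl]; omega) (by rwa [Ne, fl_eq]))
    simp only [map_add, map_brF, map_zero] at h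
    simp only [map_add, map_brF, map_zero, flipF_gi, flipG, h]
  | serreM i j m n k h3 h hi =>
    have h := mk_rel q M N (rel.serreM (fl i) (fl j) (-m) (-n) (-k) h3
      (by rw [cc_fl]; omega) (by rwa [Ne, fl_eq]))
    simp only [map_add, map_brF, map_zero] at h
    simp only [map_add, map_brF, map_zero, flipF_gi, flipG, brF_smul]
    rw [← smul_add, h, smul_zero]
  | oscP m n k u h3 hM hN =>
    have h := mk_rel q M N (rel.oscP (-k) (-n) (-m) (-u) h3 hN hM)
    have key := flip_osc q M N (flipF q M N) hq0 1 (XpF M N false) (XpA q N M false 3)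
      (fun n => by
        rw [flipF_XpF q M N _ (by omega), show M + N - (M - 1) = N + 1 by omega])
      (fun n => by
        rw [flipF_XpF q M N _ (by omega), show M + N - M = N by omega, one_smul])
      (fun n => by
        rw [flipF_XpF q M N _ (by omega), show M + N - (M + 1) = N - 1 by omega])
      (XpA_comm q M N hM hN)
    rw [map_add, map_oscOf, map_oscOf, map_zero] at h
    rw [map_add, key, key, ← smul_add, map_zero]
    refine Eq.trans (congrArg _ h) (smul_zero _)
  | oscM m n k u h3 hM hN =>
    have h := mk_rel q M N (rel.oscM (-k) (-n) (-m) (-u) h3 hN hM)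
    have key := flip_osc q M N (flipF q M N) hq0 (-1) (XmF M N false) (XmA q N M false 3)
      (fun n => by
        rw [flipF_XmF q M N _ (by omega), show M + N - (M - 1) = N + 1 by omega,
          sg, if_neg (by omega), one_smul])
      (fun n => by
        rw [flipF_XmF q M N _ (by omega), show M + N - M = N by omega, sg, if_pos rfl])
      (fun n => by
        rw [flipF_XmF q M N _ (by omega), show M + N - (M + 1) = N - 1 by omega,
          sg, if_neg (by omega), one_smul])
      (XmA_comm q M N hM hN)
    rw [map_add, map_oscOf, map_oscOf, map_zero] at h
    rw [map_add, key, key, ← smul_add, map_zero]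
    refine Eq.trans (congrArg _ h) (smul_zero _)
  | K0K0i he => exact absurd he (by decide)
  | K0iK0 he => exact absurd he (by decide)
  | K0K he => exact absurd he (by decide)
  | K0Ki he => exact absurd he (by decide)
  | K0H he => exact absurd he (by decide)
  | K0Xp he => exact absurd he (by decide)
  | K0Xm he => exact absurd he (by decide)

/-- the flip homomorphism. -/
def flipA (hq0 : q ≠ 0) : ALG q M N false 3 →ₐ[ℂ] ALG q N M false 3 :=
  RingQuot.liftAlgHom ℂ ⟨flipF q M N, fun _ _ h => flip_rel q M N hq0 h⟩

lemma flipA_mk (hq0 : q ≠ 0) (x : FA M N false) :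
    flipA q M N hq0 (mkA q M N false 3 x) = flipF q M N x :=
  RingQuot.liftAlgHom_mkAlgHom_apply ℂ _ _ _

lemma flipA_flipA (hq0 : q ≠ 0) :
    (flipA q N M hq0).comp (flipA q M N hq0) = AlgHom.id ℂ _ := by
  apply RingQuot.ringQuot_ext'
  apply FreeAlgebra.hom_ext
  funext g
  show flipA q N M hq0 (flipA q M N hq0 (mkA q M N false 3 (gi g))) = mkA q M N false 3 (gi g)
  rw [flipA_mk, flipF_gi]
  cases g with
  | Xp i n => simp only [flipG, flipA_mk, flipF_gi, fl_fl, neg_neg]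
  | Xm i n =>
    simp only [flipG, flipA_mk, flipF_gi, fl_fl, neg_neg, map_smul, smul_smul, sg_fl, sg_sq,
      one_smul]
  | K i => simp only [flipG, flipA_mk, flipF_gi, fl_fl]
  | Ki i => simp only [flipG, flipA_mk, flipF_gi, fl_fl]
  | H i s =>
    simp only [flipG, flipA_mk, flipF_gi, fl_fl, neg_neg, map_smul, smul_smul, sg_fl, sg_sq,
      one_smul]
  | K0 h => exact absurd h (by decide)
  | K0i h => exact absurd h (by decide)

end flip

end QAS

open QAS in
/-- Lemma 4.9: the superalgebra isomorphism
`π_{M,N} : U_q(Lsl(M,N)) → U_q(Lsl(N,M))` with `K_i ↦ K̄_{M+N−i}⁻¹`,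
`X⁺_{i,n} ↦ X̄⁺_{M+N−i,−n}`, `X⁻_{i,n} ↦ (−1)^{p(α_i)} X̄⁻_{M+N−i,−n}`,
`h_{i,s} ↦ (−1)^{p(α_i)} h̄_{M+N−i,−s}`. -/
theorem flip_iso (q : ℂ) (hq0 : q ≠ 0)
    (hq1 : ∀ k : ℕ, k ≠ 0 → q ^ k ≠ 1) (M N : ℕ) (hM : 1 ≤ M) (hN : 1 ≤ N) :
    ∃ π : ALG q M N false 3 ≃ₐ[ℂ] ALG q N M false 3,
      ∀ i : ℕ, 1 ≤ i → i ≤ M + N - 1 →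
        (π (KA q M N false 3 i) = KiA q N M false 3 (M + N - i)) ∧
        (∀ n : ℤ, π (XpA q M N false 3 i n) = XpA q N M false 3 (M + N - i) (-n)) ∧
        (∀ n : ℤ, π (XmA q M N false 3 i n) =
          (if i = M then (-1 : ℂ) else 1) • XmA q N M false 3 (M + N - i) (-n)) ∧
        (∀ s : ℤ, π (HA q M N false 3 i s) =
          (if i = M then (-1 : ℂ) else 1) • HA q N M false 3 (M + N - i) (-s)) := by
  refine ⟨AlgEquiv.ofAlgHom (flipA q M N hq0) (flipA q N M hq0) (flipA_flipA q N M hq0)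
    (flipA_flipA q M N hq0), fun i h1 h2 => ⟨?_, ?_, ?_, ?_⟩⟩
  · exact (flipA_mk q M N hq0 _).trans (flipF_KF q M N i ⟨h1, h2⟩)
  · intro n
    exact (flipA_mk q M N hq0 _).trans (flipF_XpF q M N i ⟨h1, h2⟩ n)
  · intro n
    exact (flipA_mk q M N hq0 _).trans (flipF_XmF q M N i ⟨h1, h2⟩ n)
  · intro s
    exact (flipA_mk q M N hq0 _).trans (flipF_HF q M N ⟨i, h1, h2⟩ s)
end
end
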